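/- arXiv:1501.02074 — 3 statements merged into one kernel-verified Lean document; each statement's English description precedes it below -/
import Mathlib

section
/- Let 1/3 < γ ≤ 1/2, let 𝒜 be a Banach algebra with unit 1, T ∈ (0,∞], let 𝐀 = (A¹,A²) be a bounded γ-rough driver in 𝒜 on [0,T), and let B : [0,T) → 𝒜 be bounded and measurable. Call a continuous path f : [0,T) → 𝒜 a solution of the linear rough equation with drift if the 2-index map f♮_{ts} := f_t − f_s − ∫_s^t B_r f_r dr − (A¹_{ts}+A²_{ts}) f_s is locally 3γ-Hölder. Then for every f₀ ∈ 𝒜 there exists exactly one such solution with f(0) = f₀, and a continuous path f with f(0) = f₀ is that solution if and only if it satisfies the Duhamel formula f_t = e^𝐀_{t0} f₀ + ∫_0^t e^𝐀_{tr} B_r f_r dr for all t ∈ [0,T), where (e^𝐀_{ts})_{s≤t} is the two-parameter flow generated by 𝐀 (e^𝐀_{ss} = 1, t ↦ e^𝐀_{ts} γ-Hölder on bounded intervals, and e^𝐀_{ts} − e^𝐀_{us} − (A¹_{tu}+A²_{tu}) e^𝐀_{us} locally 3γ-Hölder). -/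
/-!
STATEMENT 6 (linear rough differential equations with a linear drift;
Duhamel formula).  `T ∈ (0,∞]` is modelled as `T : EReal`.  Integrals are
Bochner (interval) integrals.
-/

/-- Chen's relations for a pair of 2-index maps on `[0,T)`. -/
def ChenRelations {A : Type} [NormedRing A] (T : EReal)
    (A1 A2 : ℝ → ℝ → A) : Prop :=
  ∀ s u t : ℝ, 0 ≤ s → s ≤ u → u ≤ t → (t : EReal) < T →
    A1 t s = A1 t u + A1 u s ∧
    A2 t s = A2 t u + A2 u s + A1 t u * A1 u s

/-- `K` is an upper bound for the rough-driver norm `‖𝐀‖`. -/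
def DriverNormBound {A : Type} [NormedRing A] (γ : ℝ) (T : EReal)
    (A1 A2 : ℝ → ℝ → A) (K : ℝ) : Prop :=
  ∀ s t : ℝ, 0 ≤ s → s ≤ t → (t : EReal) < T → t - s ≤ 1 →
    ‖A1 t s‖ ≤ K * (t - s) ^ γ ∧ ‖A2 t s‖ ≤ K * (t - s) ^ (2 * γ)

/-- A 2-index map `b` on `[0,T)` is locally `β`-Hölder. -/
def LocallyHolder {E : Type} [NormedAddCommGroup E] (β : ℝ) (T : EReal)
    (b : ℝ → ℝ → E) : Prop :=
  ∀ S : ℝ, (S : EReal) < T → ∃ C : ℝ, ∀ s t : ℝ,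
    0 ≤ s → s ≤ t → t ≤ S → t - s ≤ 1 → ‖b t s‖ ≤ C * (t - s) ^ β

/-- A 2-index map `b`, defined for `s ≤ u ≤ t < T` with base point `s`,
is locally `β`-Hölder on `[s,T)`. -/
def LocallyHolderFrom {E : Type} [NormedAddCommGroup E] (β : ℝ) (s : ℝ) (T : EReal)
    (b : ℝ → ℝ → E) : Prop :=
  ∀ S : ℝ, (S : EReal) < T → ∃ C : ℝ, ∀ u t : ℝ,
    s ≤ u → u ≤ t → t ≤ S → t - u ≤ 1 → ‖b t u‖ ≤ C * (t - u) ^ β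

/-- `f` is a solution of the linear rough equation with drift `B`:
it is continuous on `[0,T)` and the 2-index map
`f♮ t s := f t - f s - ∫_s^t B r * f r dr - (A1 t s + A2 t s) * f s`
is locally 3γ-Hölder. -/
def IsDriftSolution {A : Type} [NormedRing A] [NormedAlgebra ℝ A] (γ : ℝ) (T : EReal)
    (A1 A2 : ℝ → ℝ → A) (B : ℝ → A) (f : ℝ → A) : Prop :=
  ContinuousOn f {t : ℝ | 0 ≤ t ∧ (t : EReal) < T} ∧
  LocallyHolder (3 * γ) T
    (fun t s => f t - f s - (∫ r in s..t, B r * f r) - (A1 t s + A2 t s) * f s)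

section BorelPreimage

open MeasureTheory Set

/-- There is a set of real numbers which is not Borel. -/
theorem exists_not_measurableSet_real : ∃ Z : Set ℝ, ¬ MeasurableSet Z := by
  by_contra! h
  obtain ⟨b, hbc, hb⟩ := MeasurableSpace.CountablyGenerated.isCountablyGenerated (α := ℝ)
  have hle := MeasurableSpace.cardinal_measurableSet_le_continuum (s := b)
    (hbc.le_aleph0.trans Cardinal.aleph0_le_continuum)
  rw [← hb] at hle
  have huniv : {t : Set ℝ | MeasurableSet t} = Set.univ := Set.eq_univ_of_forall h
  rw [huniv, Cardinal.mk_univ, Cardinal.mk_set, Cardinal.mk_real] at hle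
  exact absurd hle (not_le.2 (Cardinal.cantor _))

/-- If the preimage of every subset of `D` under a map from a standard Borel space is measurable,
then only countably many points of `D` are attained. -/
theorem countable_of_forall_measurableSet_preimage {X Y : Type*} [MeasurableSpace X]
    [StandardBorelSpace X] {f : X → Y} {D : Set Y} (hD : D ⊆ range f)
    (h : ∀ D' ⊆ D, MeasurableSet (f ⁻¹' D')) : D.Countable := by
  obtain ⟨Z, hZ⟩ := exists_not_measurableSet_real
  rcases D.eq_empty_or_nonempty with rfl | ⟨y₀, hy₀⟩
  · exact countable_empty
  have : Nonempty X := ⟨(hD hy₀).choose⟩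
  choose! s hs using fun y (hy : y ∈ D) => hD hy
  have key : ∀ W ⊆ s '' D, MeasurableSet W := by
    intro W hW
    have hpre : ∀ U : Set X, MeasurableSet {x | f x ∈ D ∧ s (f x) ∈ U} := fun U =>
      h {y | y ∈ D ∧ s y ∈ U} fun y hy => hy.1
    have hX : MeasurableSet (f ⁻¹' D) := h D subset_rfl
    have hmeas : Measurable fun x : f ⁻¹' D => s (f x) := fun U _ =>
      ⟨{x | f x ∈ D ∧ s (f x) ∈ U}, hpre U, by
        ext x; exact and_iff_right x.2⟩
    have hfix : MeasurableSet {x : f ⁻¹' D | s (f x) = x} :=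
      measurableSet_eq_fun hmeas measurable_subtype_coe
    have : W = Subtype.val '' {x : f ⁻¹' D | s (f x) = x} ∩ {x | f x ∈ D ∧ s (f x) ∈ W} := by
      ext x
      constructor
      · intro hx
        obtain ⟨y, hy, rfl⟩ := hW hx
        have : f (s y) = y := hs y hy
        refine ⟨⟨⟨s y, by simpa [this] using hy⟩, by simp [this], rfl⟩, ?_⟩
        simpa [this, hy] using hx
      · rintro ⟨⟨x', hx', rfl⟩, hx⟩
        have := hx.2
        rwa [hx'] at this
    rw [this]
    exact (hX.subtype_image hfix).inter (hpre W)
  by_contra hDc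
  have hsD : ¬ (s '' D).Countable := by
    intro hc
    exact hDc ((hc.image f).mono fun y hy =>
      (⟨s y, mem_image_of_mem s hy, hs y hy⟩ : y ∈ f '' (s '' D)))
  have : StandardBorelSpace (s '' D) := (key _ subset_rfl).standardBorel
  let φ : (s '' D) ≃ᵐ ℝ := PolishSpace.measurableEquivOfNotCountable
    (by simpa [Set.countable_coe_iff] using hsD) not_countable
  apply hZ
  have h1 : MeasurableSet (φ ⁻¹' Z) := by
    refine ⟨Subtype.val '' (φ ⁻¹' Z), key _ (by rintro _ ⟨x, _, rfl⟩; exact x.2), ?_⟩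
    exact Set.preimage_image_eq _ Subtype.val_injective
  exact φ.measurableSet_preimage.1 h1

/-- A measurable map from a standard Borel space to a metric space is strongly measurable. -/
theorem Measurable.stronglyMeasurable_of_standardBorel {X Y : Type*} [MeasurableSpace X]
    [StandardBorelSpace X] [MetricSpace Y] [MeasurableSpace Y] [BorelSpace Y] {f : X → Y}
    (hf : Measurable f) : StronglyMeasurable f := by
  refine stronglyMeasurable_iff_measurable_separable.2 ⟨hf, ?_⟩
  obtain ⟨c, -, hcc, hc⟩ : ∃ c, c ⊆ range f ∧ c.Countable ∧ range f ⊆ closure c := by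
    refine EMetric.subset_countable_closure_of_almost_dense_set _ fun ε hε => ?_
    obtain ⟨δ, hδ, hδε⟩ := ENNReal.lt_iff_exists_nnreal_btwn.1 hε
    have hδ0 : 0 < (δ : ℝ) := by exact_mod_cast hδ
    obtain ⟨D, hD⟩ := zorn_subset {D : Set Y | D ⊆ range f ∧ Metric.IsSeparated δ D} (by
      intro c hc hchain
      refine ⟨⋃₀ c, ⟨sUnion_subset fun D hD => (hc hD).1, ?_⟩, fun D hD => subset_sUnion_of_mem hD⟩
      exact (pairwise_sUnion hchain.directedOn).2 fun D hD => (hc hD).2)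
    refine ⟨D, countable_of_forall_measurableSet_preimage hD.prop.1 fun D' hD' => ?_, ?_⟩
    · refine hf (Metric.isClosed_of_pairwise_le_dist hδ0 fun x hx y hy hxy => ?_).measurableSet
      have hlt : (δ : ENNReal) < EDist.edist x y := hD.prop.2 (hD' hx) (hD' hy) hxy
      rw [edist_nndist] at hlt
      change (δ : ℝ) ≤ Dist.dist x y
      exact_mod_cast hlt.le
    · have := Metric.isCover_iff_subset_iUnion_closedEBall.1
        (Metric.IsCover.of_maximal_isSeparated hD)
      exact this.trans (iUnion₂_mono fun x _ => Metric.closedEBall_subset_closedEBall hδε.le)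
  exact ⟨c, hcc, hc⟩

end BorelPreimage

/-- The remainder of `y` as a solution of the linear rough equation driven by `(A1, A2)`. -/
def roughRemainder {A : Type} [NormedRing A] (A1 A2 : ℝ → ℝ → A) (y : ℝ → A) (t s : ℝ) : A :=
  y t - y s - (A1 t s + A2 t s) * y s

/-- `y` solves the (driftless) linear rough equation driven by `(A1, A2)` on `[a, b]`. -/
def IsRoughSolutionOn {A : Type} [NormedRing A] (γ : ℝ) (A1 A2 : ℝ → ℝ → A) (y : ℝ → A)
    (a b : ℝ) : Prop :=
  ∃ N : ℝ, ∀ s t : ℝ, a ≤ s → s ≤ t → t ≤ b → t - s ≤ 1 →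
    ‖roughRemainder A1 A2 y t s‖ ≤ N * (t - s) ^ (3 * γ)

theorem EReal.coe_lt_of_le_of_coe_lt {s t : ℝ} {T : EReal} (h : s ≤ t) (ht : (t : EReal) < T) :
    (s : EReal) < T :=
  lt_of_le_of_lt (EReal.coe_le_coe_iff.2 h) ht

/-- A bound that is improved by an affine contraction holds at the fixed point. -/
theorem le_mul_of_affine_contraction {P : ℝ → Prop} {θ q N₀ x w : ℝ} (hθ0 : 0 ≤ θ) (hθ1 : θ < 1)
    (hq : 0 ≤ q) (hN₀ : 0 ≤ N₀) (h0 : P N₀) (step : ∀ N, 0 ≤ N → P N → P (θ * N + q))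
    (hx : ∀ N, P N → x ≤ N * w) : x ≤ q / (1 - θ) * w := by
  have h1 : 0 < 1 - θ := by linarith
  have hP : ∀ n : ℕ, P (θ ^ n * N₀ + q * ∑ i ∈ Finset.range n, θ ^ i) := by
    intro n
    induction n with
    | zero => simpa using h0
    | succ n ih =>
      have := step _ (by positivity) ih
      convert this using 1
      rw [Finset.sum_range_succ', pow_succ, pow_zero]
      simp only [pow_succ, ← Finset.sum_mul]
      ring
  have hlim : Filter.Tendsto (fun n : ℕ => (θ ^ n * N₀ + q * ∑ i ∈ Finset.range n, θ ^ i) * w)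
      Filter.atTop (nhds ((0 * N₀ + q * (1 - θ)⁻¹) * w)) :=
    ((((tendsto_pow_atTop_nhds_zero_of_lt_one hθ0 hθ1).mul_const N₀).add
      ((hasSum_geometric_of_lt_one hθ0 hθ1).tendsto_sum_nat.const_mul q)).mul_const w)
  have := ge_of_tendsto' hlim fun n => hx _ (hP n)
  simpa [div_eq_mul_inv] using this

section RoughEstimates

variable {A : Type} [NormedRing A] {γ : ℝ} {T : EReal} {A1 A2 : ℝ → ℝ → A} {K : ℝ}

theorem roughRemainder_eq_of_chen (hChen : ChenRelations T A1 A2) (y : ℝ → A) {s u t : ℝ}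
    (hs : 0 ≤ s) (hsu : s ≤ u) (hut : u ≤ t) (ht : (t : EReal) < T) :
    roughRemainder A1 A2 y t s = roughRemainder A1 A2 y t u + roughRemainder A1 A2 y u s +
      (A1 t u + A2 t u) * roughRemainder A1 A2 y u s +
      (A1 t u * A2 u s + A2 t u * A1 u s + A2 t u * A2 u s) * y s := by
  obtain ⟨h1, h2⟩ := hChen s u t hs hsu hut ht
  simp only [roughRemainder, h1, h2]
  noncomm_ring

theorem norm_driver_le (hγ : 0 ≤ γ) (hK : 0 ≤ K) (hNorm : DriverNormBound γ T A1 A2 K) {s t : ℝ}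
    (hs : 0 ≤ s) (hst : s ≤ t) (ht : (t : EReal) < T) (h1 : t - s ≤ 1) :
    ‖A1 t s + A2 t s‖ ≤ 2 * K * (t - s) ^ γ := by
  obtain ⟨ha, hb⟩ := hNorm s t hs hst ht h1
  have : (t - s) ^ (2 * γ) ≤ (t - s) ^ γ :=
    Real.rpow_le_rpow_of_exponent_ge_of_imp (by linarith) h1 (by linarith) (by
      intro h h'; linarith)
  calc ‖A1 t s + A2 t s‖ ≤ ‖A1 t s‖ + ‖A2 t s‖ := norm_add_le _ _
    _ ≤ K * (t - s) ^ γ + K * (t - s) ^ γ := by gcongr; exact hb.trans (by gcongr)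
    _ = _ := by ring

theorem norm_le_of_roughRemainder_le (hγ : 0 ≤ γ) (hK : 0 ≤ K)
    (hNorm : DriverNormBound γ T A1 A2 K) {y : ℝ → A} {s t c : ℝ}
    (hs : 0 ≤ s) (hst : s ≤ t) (ht : (t : EReal) < T) (h1 : t - s ≤ 1)
    (hR : ‖roughRemainder A1 A2 y t s‖ ≤ c) : ‖y t‖ ≤ (1 + 2 * K) * ‖y s‖ + c := by
  have h2 : ‖A1 t s + A2 t s‖ ≤ 2 * K :=
    (norm_driver_le hγ hK hNorm hs hst ht h1).trans
      (mul_le_of_le_one_right (by positivity) (Real.rpow_le_one (by linarith) h1 hγ))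
  have : y t = y s + (A1 t s + A2 t s) * y s + roughRemainder A1 A2 y t s := by
    simp only [roughRemainder]; noncomm_ring
  rw [this]
  calc _ ≤ ‖y s‖ + ‖A1 t s + A2 t s‖ * ‖y s‖ + ‖roughRemainder A1 A2 y t s‖ :=
        (norm_add_le _ _).trans (by gcongr; exact (norm_add_le _ _).trans (by
          gcongr; exact norm_mul_le _ _))
    _ ≤ ‖y s‖ + 2 * K * ‖y s‖ + c := by gcongr
    _ = _ := by ring

/-- Halving the interval improves a bound on the remainder of a solution. -/
theorem roughRemainder_le_of_le (hγ1 : 1 / 3 < γ) (hK : 0 ≤ K)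
    (hChen : ChenRelations T A1 A2) (hNorm : DriverNormBound γ T A1 A2 K) {y : ℝ → A}
    {a b h₀ N : ℝ} (ha : 0 ≤ a) (hb : (b : EReal) < T) (hh₀ : h₀ ≤ 1) (hab : b - a ≤ h₀)
    (hN : 0 ≤ N)
    (hR : ∀ s t, a ≤ s → s ≤ t → t ≤ b → ‖roughRemainder A1 A2 y t s‖ ≤ N * (t - s) ^ (3 * γ))
    {s t : ℝ} (has : a ≤ s) (hst : s ≤ t) (htb : t ≤ b) :
    ‖roughRemainder A1 A2 y t s‖ ≤
      (((2 : ℝ) ^ (1 - 3 * γ) + (2 * K + 3 * K ^ 2) * h₀ ^ γ) * N +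
        3 * K ^ 2 * (1 + 2 * K) * ‖y a‖) * (t - s) ^ (3 * γ) := by
  have hγ0 : 0 < γ := by linarith
  have hs0 : 0 ≤ s := ha.trans has
  have htT := EReal.coe_lt_of_le_of_coe_lt htb hb
  have hsT := EReal.coe_lt_of_le_of_coe_lt hst htT
  set u : ℝ := (s + t) / 2 with hu
  have hsu : s ≤ u := by linarith
  have hut : u ≤ t := by linarith
  have huT := EReal.coe_lt_of_le_of_coe_lt hut htT
  have hts0 : 0 ≤ t - s := by linarith
  have hh₀0 : 0 ≤ h₀ := by linarith
  have e1 : t - u = (t - s) / 2 := by rw [hu]; ring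
  have e2 : u - s = (t - s) / 2 := by rw [hu]; ring
  set x : ℝ := (t - s) ^ γ with hx
  set η : ℝ := h₀ ^ γ with hη
  set p : ℝ := ((t - s) / 2) ^ (3 * γ) with hp
  have hx0 : 0 ≤ x := by positivity
  have hp0 : 0 ≤ p := by positivity
  have hη0 : 0 ≤ η := by positivity
  have hxη : x ≤ η := Real.rpow_le_rpow hts0 (by linarith) hγ0.le
  have hη1 : η ≤ 1 := Real.rpow_le_one hh₀0 hh₀ hγ0.le
  have hx3 : (t - s) ^ (3 * γ) = x ^ 3 := by
    rw [hx, ← Real.rpow_natCast, ← Real.rpow_mul hts0]; congr 1; push_cast; ring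
  have hhalf : ((t - s) / 2) ^ γ ≤ x := Real.rpow_le_rpow (by positivity) (by linarith) hγ0.le
  have hhalf2 : ((t - s) / 2) ^ (2 * γ) ≤ x ^ 2 := by
    have : ((t - s) / 2) ^ (2 * γ) = (((t - s) / 2) ^ γ) ^ 2 := by
      rw [← Real.rpow_natCast, ← Real.rpow_mul (by positivity)]; congr 1; push_cast; ring
    rw [this]; gcongr
  have hp2 : 2 * p = (2 : ℝ) ^ (1 - 3 * γ) * x ^ 3 := by
    rw [hp, Real.div_rpow hts0 (by norm_num), hx3, Real.rpow_sub (by norm_num), Real.rpow_one]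
    field_simp
  have hpx : p ≤ x ^ 3 := by
    rw [← hx3]; exact Real.rpow_le_rpow (by positivity) (by linarith) (by positivity)
  have hR1 : ‖roughRemainder A1 A2 y t u‖ ≤ N * p := by
    have := hR u t (by linarith) hut htb; rwa [e1] at this
  have hR2 : ‖roughRemainder A1 A2 y u s‖ ≤ N * p := by
    have := hR s u has hsu (by linarith); rwa [e2] at this
  have hA : ‖A1 t u + A2 t u‖ ≤ 2 * K * η := by
    have := norm_driver_le hγ0.le hK hNorm (hs0.trans hsu) hut htT (by linarith)
    rw [e1] at this
    exact this.trans (by gcongr; exact hhalf.trans hxη)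
  obtain ⟨htu1, htu2⟩ := hNorm u t (hs0.trans hsu) hut htT (by linarith)
  obtain ⟨hus1, hus2⟩ := hNorm s u hs0 hsu huT (by linarith)
  rw [e1] at htu1 htu2
  rw [e2] at hus1 hus2
  replace htu1 := htu1.trans (mul_le_mul_of_nonneg_left hhalf hK)
  replace htu2 := htu2.trans (mul_le_mul_of_nonneg_left hhalf2 hK)
  replace hus1 := hus1.trans (mul_le_mul_of_nonneg_left hhalf hK)
  replace hus2 := hus2.trans (mul_le_mul_of_nonneg_left hhalf2 hK)
  have hx1 : x ≤ 1 := hxη.trans hη1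
  have hD : ‖A1 t u * A2 u s + A2 t u * A1 u s + A2 t u * A2 u s‖ ≤ 3 * K ^ 2 * x ^ 3 := by
    calc _ ≤ ‖A1 t u‖ * ‖A2 u s‖ + ‖A2 t u‖ * ‖A1 u s‖ + ‖A2 t u‖ * ‖A2 u s‖ :=
          (norm_add_le _ _).trans (add_le_add ((norm_add_le _ _).trans
            (add_le_add (norm_mul_le _ _) (norm_mul_le _ _))) (norm_mul_le _ _))
      _ ≤ (K * x) * (K * x ^ 2) + (K * x ^ 2) * (K * x) + (K * x ^ 2) * (K * x ^ 2) := by gcongr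
      _ = 2 * K ^ 2 * x ^ 3 + K ^ 2 * x ^ 3 * x := by ring
      _ ≤ 2 * K ^ 2 * x ^ 3 + K ^ 2 * x ^ 3 * 1 := by gcongr
      _ = _ := by ring
  have hys : ‖y s‖ ≤ (1 + 2 * K) * ‖y a‖ + N * η := by
    refine norm_le_of_roughRemainder_le hγ0.le hK hNorm ha has hsT (by linarith)
      ((hR a s le_rfl has (by linarith)).trans ?_)
    gcongr
    calc (s - a) ^ (3 * γ) ≤ h₀ ^ (3 * γ) :=
          Real.rpow_le_rpow (by linarith) (by linarith) (by positivity)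
      _ ≤ η := Real.rpow_le_rpow_of_exponent_ge_of_imp hh₀0 hh₀ (by linarith) (by
          intro h h'; linarith)
  rw [roughRemainder_eq_of_chen hChen y hs0 hsu hut htT, hx3]
  calc _ ≤ ‖roughRemainder A1 A2 y t u‖ + ‖roughRemainder A1 A2 y u s‖ +
        ‖A1 t u + A2 t u‖ * ‖roughRemainder A1 A2 y u s‖ +
        ‖A1 t u * A2 u s + A2 t u * A1 u s + A2 t u * A2 u s‖ * ‖y s‖ :=
        (norm_add_le _ _).trans (add_le_add ((norm_add_le _ _).trans
            (add_le_add (norm_add_le _ _) (norm_mul_le _ _))) (norm_mul_le _ _))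
    _ ≤ N * p + N * p + 2 * K * η * (N * x ^ 3) +
        3 * K ^ 2 * x ^ 3 * ((1 + 2 * K) * ‖y a‖ + N * η) := by
        gcongr; exact hR2.trans (by gcongr)
    _ = N * (2 * p) + 2 * K * η * (N * x ^ 3) +
        3 * K ^ 2 * x ^ 3 * ((1 + 2 * K) * ‖y a‖ + N * η) := by ring
    _ = _ := by rw [hp2]; ring

/-- A priori estimate for the remainder of a solution on short intervals. -/
theorem exists_roughRemainder_le (hγ1 : 1 / 3 < γ) (hK : 0 ≤ K)
    (hChen : ChenRelations T A1 A2) (hNorm : DriverNormBound γ T A1 A2 K) :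
    ∃ h₀ C : ℝ, 0 < h₀ ∧ h₀ ≤ 1 ∧ 0 ≤ C ∧ ∀ (y : ℝ → A) (a b : ℝ), 0 ≤ a → a ≤ b →
      (b : EReal) < T → b - a ≤ h₀ → IsRoughSolutionOn γ A1 A2 y a b →
        ‖roughRemainder A1 A2 y b a‖ ≤ C * ‖y a‖ * (b - a) ^ (3 * γ) := by
  have hγ0 : 0 < γ := by linarith
  have hρ : (2 : ℝ) ^ (1 - 3 * γ) < 1 :=
    Real.rpow_lt_one_of_one_lt_of_neg (by norm_num) (by linarith)
  set ρ : ℝ := (2 : ℝ) ^ (1 - 3 * γ)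
  have hlim : Filter.Tendsto (fun h : ℝ => ρ + (2 * K + 3 * K ^ 2) * h ^ γ)
      (nhdsWithin 0 (Set.Ioi 0)) (nhds (ρ + (2 * K + 3 * K ^ 2) * (0 : ℝ) ^ γ)) :=
    ((Real.continuousAt_rpow_const 0 γ (Or.inr hγ0.le)).tendsto.const_mul _ |>.const_add _).mono_left
      nhdsWithin_le_nhds
  rw [Real.zero_rpow hγ0.ne', mul_zero, add_zero] at hlim
  obtain ⟨h₀, hlt, hh₀⟩ := ((hlim.eventually_lt_const hρ).and
    (Ioc_mem_nhdsGT (zero_lt_one' ℝ))).exists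
  set θ : ℝ := ρ + (2 * K + 3 * K ^ 2) * h₀ ^ γ with hθ
  have hρ0 : 0 ≤ ρ := by positivity
  have hθ0 : 0 ≤ θ := by have := hh₀.1; positivity
  have h1θ : 0 < 1 - θ := by linarith
  refine ⟨h₀, 3 * K ^ 2 * (1 + 2 * K) / (1 - θ), hh₀.1, hh₀.2, by positivity, ?_⟩
  rintro y a b ha hab hb hbh ⟨N, hN⟩
  have := le_mul_of_affine_contraction (θ := θ) (q := 3 * K ^ 2 * (1 + 2 * K) * ‖y a‖)
    (N₀ := max N 0) (x := ‖roughRemainder A1 A2 y b a‖) (w := (b - a) ^ (3 * γ))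
    (P := fun N => ∀ s t, a ≤ s → s ≤ t → t ≤ b →
      ‖roughRemainder A1 A2 y t s‖ ≤ N * (t - s) ^ (3 * γ))
    hθ0 hlt (by positivity) (le_max_right _ _)
    (fun s t h1 h2 h3 => (hN s t h1 h2 h3 (by linarith [hh₀.2])).trans (by
      have : 0 ≤ t - s := by linarith
      gcongr; exact le_max_left _ _))
    (fun N hN0 hN s t h1 h2 h3 =>
      roughRemainder_le_of_le hγ1 hK hChen hNorm ha hb hh₀.2 hbh hN0 hN h1 h2 h3)
    (fun N hN => hN a b le_rfl hab le_rfl)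
  refine this.trans (le_of_eq ?_)
  ring

theorem IsRoughSolutionOn.mono {y : ℝ → A} {a b a' b' : ℝ} (h : IsRoughSolutionOn γ A1 A2 y a b)
    (ha : a ≤ a') (hb : b' ≤ b) : IsRoughSolutionOn γ A1 A2 y a' b' := by
  obtain ⟨N, hN⟩ := h
  exact ⟨N, fun s t h1 h2 h3 h4 => hN s t (ha.trans h1) h2 (h3.trans hb) h4⟩

/-- A priori growth estimate for solutions. -/
theorem exists_norm_le_of_isRoughSolutionOn (hγ1 : 1 / 3 < γ) (hK : 0 ≤ K)
    (hChen : ChenRelations T A1 A2) (hNorm : DriverNormBound γ T A1 A2 K) (L : ℝ) :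
    ∃ M : ℝ, 0 ≤ M ∧ ∀ (y : ℝ → A) (a b : ℝ), 0 ≤ a → a ≤ b → (b : EReal) < T → b - a ≤ L →
      IsRoughSolutionOn γ A1 A2 y a b → ‖y b‖ ≤ M * ‖y a‖ := by
  have hγ0 : 0 < γ := by linarith
  obtain ⟨h₀, C, hh0, hh1, hC, hmain⟩ := exists_roughRemainder_le hγ1 hK hChen hNorm
  have hshort : ∀ (y : ℝ → A) (a b : ℝ), 0 ≤ a → a ≤ b → (b : EReal) < T → b - a ≤ h₀ →
      IsRoughSolutionOn γ A1 A2 y a b → ‖y b‖ ≤ (1 + 2 * K + C) * ‖y a‖ := by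
    intro y a b ha hab hb hbh hy
    have h1 := norm_le_of_roughRemainder_le hγ0.le hK hNorm ha hab hb (hbh.trans hh1)
      (hmain y a b ha hab hb hbh hy)
    have h2 : C * ‖y a‖ * (b - a) ^ (3 * γ) ≤ C * ‖y a‖ :=
      mul_le_of_le_one_right (by positivity)
        (Real.rpow_le_one (by linarith) (by linarith) (by positivity))
    linarith
  have hlong : ∀ (n : ℕ) (y : ℝ → A) (a b : ℝ), 0 ≤ a → a ≤ b → (b : EReal) < T →
      b - a ≤ n * h₀ → IsRoughSolutionOn γ A1 A2 y a b →
        ‖y b‖ ≤ (1 + 2 * K + C) ^ n * ‖y a‖ := by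
    intro n
    induction n with
    | zero =>
      intro y a b ha hab hb hbh hy
      have : b = a := by push_cast at hbh; linarith
      simp [this]
    | succ n ih =>
      intro y a b ha hab hb hbh hy
      push_cast at hbh
      have hn : 0 ≤ (n : ℝ) * h₀ := by positivity
      have hac : a ≤ max a (b - h₀) := le_max_left _ _
      have hcb : max a (b - h₀) ≤ b := max_le hab (by linarith)
      have hbc := le_max_right a (b - h₀)
      have hca : max a (b - h₀) - a ≤ n * h₀ := by
        have : max a (b - h₀) ≤ a + n * h₀ := max_le (by linarith) (by linarith)
        linarith
      generalize max a (b - h₀) = c at *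
      have h1 := hshort y c b (ha.trans hac) hcb hb (by linarith) (hy.mono hac le_rfl)
      have h2 := ih y a c ha hac (EReal.coe_lt_of_le_of_coe_lt hcb hb) hca (hy.mono le_rfl hcb)
      calc ‖y b‖ ≤ (1 + 2 * K + C) * ‖y c‖ := h1
        _ ≤ (1 + 2 * K + C) * ((1 + 2 * K + C) ^ n * ‖y a‖) := by gcongr
        _ = _ := by ring
  obtain ⟨n, hn⟩ := exists_nat_ge (L / h₀)
  refine ⟨(1 + 2 * K + C) ^ n, by positivity, fun y a b ha hab hb hbL hy =>
    hlong n y a b ha hab hb (hbL.trans ?_) hy⟩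
  rwa [div_le_iff₀ hh0] at hn

end RoughEstimates

/-- `e` is a two-parameter flow on `[0, S]` which is close to `1 + A1 + A2` with constant `M`. -/
structure IsRoughFlowOn {A : Type} [NormedRing A] (γ S M : ℝ) (A1 A2 e : ℝ → ℝ → A) : Prop where
  nonneg : 0 ≤ M
  refl : ∀ s, 0 ≤ s → s ≤ S → e s s = 1
  comp : ∀ s u t, 0 ≤ s → s ≤ u → u ≤ t → t ≤ S → e t s = e t u * e u s
  norm_le : ∀ s t, 0 ≤ s → s ≤ t → t ≤ S → ‖e t s‖ ≤ M
  norm_sub_one_le : ∀ s t, 0 ≤ s → s ≤ t → t ≤ S → t - s ≤ 1 → ‖e t s - 1‖ ≤ M * (t - s) ^ γ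
  remainder_le : ∀ s t, 0 ≤ s → s ≤ t → t ≤ S → t - s ≤ 1 →
    ‖e t s - 1 - (A1 t s + A2 t s)‖ ≤ M * (t - s) ^ (3 * γ)

theorem exists_isRoughFlowOn {A : Type} [NormedRing A] {γ : ℝ} {T : EReal}
    {A1 A2 e : ℝ → ℝ → A} {K : ℝ} (hγ1 : 1 / 3 < γ) (hK : 0 ≤ K)
    (hChen : ChenRelations T A1 A2) (hNorm : DriverNormBound γ T A1 A2 K)
    (hinit : ∀ s : ℝ, 0 ≤ s → (s : EReal) < T → e s s = 1)
    (hRem : ∀ s : ℝ, 0 ≤ s → (s : EReal) < T →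
      LocallyHolderFrom (3 * γ) s T (fun t u => e t s - e u s - (A1 t u + A2 t u) * e u s))
    {S : ℝ} (hS : (S : EReal) < T) : ∃ M : ℝ, IsRoughFlowOn γ S M A1 A2 e := by
  have hγ0 : 0 < γ := by linarith
  have hlt : ∀ {t : ℝ}, t ≤ S → (t : EReal) < T := fun h => EReal.coe_lt_of_le_of_coe_lt h hS
  have hsol : ∀ s t, 0 ≤ s → s ≤ S → t ≤ S →
      IsRoughSolutionOn γ A1 A2 (fun r => e r s) s t := by
    intro s t hs hsS htS
    obtain ⟨N, hN⟩ := hRem s hs (hlt hsS) t (hlt htS)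
    exact ⟨N, hN⟩
  obtain ⟨M₀, hM₀, hgrow⟩ := exists_norm_le_of_isRoughSolutionOn hγ1 hK hChen hNorm S
  obtain ⟨h₀, C, hh0, hh1, hC, hshort⟩ := exists_roughRemainder_le hγ1 hK hChen hNorm
  have hnorm : ∀ s t, 0 ≤ s → s ≤ t → t ≤ S → ‖e t s‖ ≤ M₀ * ‖(1 : A)‖ := by
    intro s t hs hst htS
    have := hgrow _ s t hs hst (hlt htS) (by linarith) (hsol s t hs (hst.trans htS) htS)
    rwa [hinit s hs (hlt (hst.trans htS))] at this
  set c : ℝ := C * ‖(1 : A)‖ + (M₀ * ‖(1 : A)‖ + ‖(1 : A)‖ + 2 * K) / h₀ ^ (3 * γ) with hc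
  have hc0 : 0 ≤ c := by positivity
  have hrem : ∀ s t, 0 ≤ s → s ≤ t → t ≤ S → t - s ≤ 1 →
      ‖e t s - 1 - (A1 t s + A2 t s)‖ ≤ c * (t - s) ^ (3 * γ) := by
    intro s t hs hst htS h1
    have hi := hinit s hs (hlt (hst.trans htS))
    have hts : 0 ≤ t - s := by linarith
    rcases le_total (t - s) h₀ with h | h
    · have := hshort _ s t hs hst (hlt htS) h (hsol s t hs (hst.trans htS) htS)
      simp only [roughRemainder, hi, mul_one] at this
      refine this.trans ?_
      gcongr
      rw [hc]
      exact le_add_of_nonneg_right (by positivity)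
    · have hA : ‖A1 t s + A2 t s‖ ≤ 2 * K :=
        (norm_driver_le hγ0.le hK hNorm hs hst (hlt htS) h1).trans
          (mul_le_of_le_one_right (by positivity) (Real.rpow_le_one hts h1 hγ0.le))
      have hpow : h₀ ^ (3 * γ) ≤ (t - s) ^ (3 * γ) :=
        Real.rpow_le_rpow hh0.le h (by positivity)
      calc _ ≤ ‖e t s‖ + ‖(1 : A)‖ + ‖A1 t s + A2 t s‖ :=
            (norm_sub_le _ _).trans (by gcongr; exact norm_sub_le _ _)
        _ ≤ M₀ * ‖(1 : A)‖ + ‖(1 : A)‖ + 2 * K := by gcongr; exact hnorm s t hs hst htS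
        _ = (M₀ * ‖(1 : A)‖ + ‖(1 : A)‖ + 2 * K) / h₀ ^ (3 * γ) * h₀ ^ (3 * γ) := by
            rw [div_mul_cancel₀]; positivity
        _ ≤ c * (t - s) ^ (3 * γ) := by
            gcongr
            exact le_add_of_nonneg_left (by positivity)
  refine ⟨M₀ * ‖(1 : A)‖ + c + 2 * K, by positivity, fun s hs hsS => hinit s hs (hlt hsS),
    ?_, ?_, ?_, ?_⟩
  · intro s u t hs hsu hut htS
    have huS := hut.trans htS
    have hu := hs.trans hsu
    obtain ⟨N₁, hN₁⟩ := (hsol s t hs (hsu.trans huS) htS).mono hsu le_rfl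
    obtain ⟨N₂, hN₂⟩ := hsol u t hu huS htS
    have hy : IsRoughSolutionOn γ A1 A2 (fun r => e r s - e r u * e u s) u t := by
      refine ⟨N₁ + N₂ * ‖e u s‖, fun q r hq hqr hr h1 => ?_⟩
      have heq : roughRemainder A1 A2 (fun r => e r s - e r u * e u s) r q =
          roughRemainder A1 A2 (fun r => e r s) r q -
            roughRemainder A1 A2 (fun r => e r u) r q * e u s := by
        simp only [roughRemainder]; noncomm_ring
      rw [heq]
      calc _ ≤ ‖roughRemainder A1 A2 (fun r => e r s) r q‖ +
            ‖roughRemainder A1 A2 (fun r => e r u) r q‖ * ‖e u s‖ :=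
            (norm_sub_le _ _).trans (by gcongr; exact norm_mul_le _ _)
        _ ≤ N₁ * (r - q) ^ (3 * γ) + N₂ * (r - q) ^ (3 * γ) * ‖e u s‖ := by
            gcongr
            · exact hN₁ q r hq hqr hr h1
            · exact hN₂ q r hq hqr hr h1
        _ = _ := by ring
    have := hgrow _ u t hu hut (hlt htS) (by linarith) hy
    simp only [hinit u hu (hlt huS), one_mul, sub_self, norm_zero, mul_zero,
      norm_le_zero_iff] at this
    exact sub_eq_zero.1 this
  · intro s t hs hst htS
    have := hnorm s t hs hst htS
    linarith
  · intro s t hs hst htS h1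
    have hts : 0 ≤ t - s := by linarith
    have h3 : (t - s) ^ (3 * γ) ≤ (t - s) ^ γ :=
      Real.rpow_le_rpow_of_exponent_ge_of_imp hts h1 (by linarith) (by intro h h'; linarith)
    have : e t s - 1 = (e t s - 1 - (A1 t s + A2 t s)) + (A1 t s + A2 t s) := by abel
    rw [this]
    calc _ ≤ c * (t - s) ^ (3 * γ) + 2 * K * (t - s) ^ γ :=
          (norm_add_le _ _).trans (add_le_add (hrem s t hs hst htS h1)
            (norm_driver_le hγ0.le hK hNorm hs hst (hlt htS) h1))
      _ ≤ c * (t - s) ^ γ + 2 * K * (t - s) ^ γ := by gcongr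
      _ ≤ M₀ * ‖(1 : A)‖ * (t - s) ^ γ + (c * (t - s) ^ γ + 2 * K * (t - s) ^ γ) :=
          le_add_of_nonneg_left (by positivity)
      _ = _ := by ring
  · intro s t hs hst htS h1
    have hts : 0 ≤ t - s := by linarith
    refine (hrem s t hs hst htS h1).trans ?_
    gcongr
    have : 0 ≤ M₀ * ‖(1 : A)‖ := by positivity
    linarith

theorem tendsto_const_mul_abs_sub_rpow {β : ℝ} (hβ : 0 < β) (C x : ℝ) (U : Set ℝ) :
    Filter.Tendsto (fun y : ℝ => C * |y - x| ^ β) (nhdsWithin x U) (nhds 0) := by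
  have h : ContinuousAt (fun y : ℝ => C * |y - x| ^ β) x :=
    continuousAt_const.mul (ContinuousAt.rpow_const (by fun_prop) (Or.inr hβ.le))
  have h0 : C * |x - x| ^ β = 0 := by simp [Real.zero_rpow hβ.ne']
  have := h.tendsto
  rw [h0] at this
  exact this.mono_left nhdsWithin_le_nhds

theorem continuousOn_Icc_of_norm_sub_le {E : Type*} [NormedAddCommGroup E] {g : ℝ → E}
    {a b C β : ℝ} (hβ : 0 < β)
    (h : ∀ s t, a ≤ s → s ≤ t → t ≤ b → t - s ≤ 1 → ‖g t - g s‖ ≤ C * (t - s) ^ β) :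
    ContinuousOn g (Set.Icc a b) := by
  intro x hx
  have hlim := tendsto_const_mul_abs_sub_rpow hβ C x (Set.Icc a b)
  have hnear : ∀ᶠ y in nhdsWithin x (Set.Icc a b), |y - x| < 1 :=
    nhdsWithin_le_nhds (Metric.ball_mem_nhds x one_pos)
  refine tendsto_iff_norm_sub_tendsto_zero.2
    (squeeze_zero' (Filter.Eventually.of_forall fun _ => norm_nonneg _) ?_ hlim)
  filter_upwards [hnear, self_mem_nhdsWithin] with y hy1 hy
  rcases le_total x y with hxy | hxy
  · rw [abs_of_nonneg (sub_nonneg.2 hxy)] at hy1 ⊢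
    exact h x y hx.1 hxy hy.2 hy1.le
  · rw [abs_sub_comm, abs_of_nonneg (sub_nonneg.2 hxy)] at hy1 ⊢
    rw [norm_sub_rev]
    exact h y x hy.1 hxy hx.2 hy1.le

theorem eq_of_norm_sub_le_rpow {E : Type*} [NormedAddCommGroup E] [NormedSpace ℝ E] {g : ℝ → E}
    {a b C β : ℝ} (hab : a ≤ b) (hβ : 1 < β)
    (h : ∀ s t, a ≤ s → s ≤ t → t ≤ b → t - s ≤ 1 → ‖g t - g s‖ ≤ C * (t - s) ^ β) :
    g b = g a := by
  refine constant_of_has_deriv_right_zero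
    (continuousOn_Icc_of_norm_sub_le (by linarith) h) (fun x hx => ?_) b ⟨hab, le_rfl⟩
  rw [hasDerivWithinAt_iff_tendsto]
  have hβ0 : 0 < β - 1 := by linarith
  have hlim := tendsto_const_mul_abs_sub_rpow hβ0 C x (Set.Ici x)
  have hnear : ∀ᶠ y in nhdsWithin x (Set.Ici x), |y - x| < 1 :=
    nhdsWithin_le_nhds (Metric.ball_mem_nhds x one_pos)
  have hlt : ∀ᶠ y in nhdsWithin x (Set.Ici x), y < b := nhdsWithin_le_nhds (Iio_mem_nhds hx.2)
  refine squeeze_zero' (Filter.Eventually.of_forall fun _ => by positivity) ?_ hlim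
  filter_upwards [hnear, hlt, self_mem_nhdsWithin] with y hy1 hyb hy
  have hxy : 0 ≤ y - x := sub_nonneg.2 hy
  rw [Real.norm_eq_abs, smul_zero, sub_zero, abs_of_nonneg hxy]
  rw [abs_of_nonneg hxy] at hy1
  rcases hxy.eq_or_lt with h0 | h0
  · simp [← h0, Real.zero_rpow hβ0.ne']
  · have := h x y hx.1 hy hyb.le hy1.le
    rw [Real.rpow_sub_one h0.ne']
    calc (y - x)⁻¹ * ‖g y - g x‖ ≤ (y - x)⁻¹ * (C * (y - x) ^ β) := by gcongr
      _ = _ := by field_simp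

/-- The defect of `f` in the Duhamel formula with forcing `φ` between the times `s` and `t`. -/
noncomputable def duhamelDefect {A : Type} [NormedRing A] [NormedAlgebra ℝ A]
    (e : ℝ → ℝ → A) (φ f : ℝ → A) (t s : ℝ) : A :=
  f t - e t s * f s - ∫ r in s..t, e t r * φ r

namespace IsRoughFlowOn

variable {A : Type} [NormedRing A] {γ S M P : ℝ} {A1 A2 e : ℝ → ℝ → A}
  {φ f : ℝ → A}

theorem continuousOn_right (h : IsRoughFlowOn γ S M A1 A2 e) (hγ : 0 < γ) {t : ℝ} (ht : t ≤ S) :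
    ContinuousOn (fun r => e t r) (Set.Icc 0 t) := by
  refine continuousOn_Icc_of_norm_sub_le (C := M * M) hγ fun s u hs hsu hut h1 => ?_
  have : e t u - e t s = e t u * (1 - e u s) := by
    rw [h.comp s u t hs hsu hut ht]; noncomm_ring
  rw [this]
  have hus : 0 ≤ u - s := by linarith
  calc _ ≤ ‖e t u‖ * ‖1 - e u s‖ := norm_mul_le _ _
    _ ≤ M * (M * (u - s) ^ γ) := by
        gcongr
        · exact h.nonneg
        · exact h.norm_le u t (hs.trans hsu) hut ht
        · rw [norm_sub_rev]
          exact h.norm_sub_one_le s u hs hsu (hut.trans ht) h1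
    _ = _ := by ring

theorem continuousOn_left (h : IsRoughFlowOn γ S M A1 A2 e) (hγ : 0 < γ) :
    ContinuousOn (fun t => e t 0) (Set.Icc 0 S) := by
  refine continuousOn_Icc_of_norm_sub_le (C := M * M) hγ fun s t hs hst htS h1 => ?_
  have : e t 0 - e s 0 = (e t s - 1) * e s 0 := by
    rw [h.comp 0 s t le_rfl hs hst htS]; noncomm_ring
  rw [this]
  have hts : 0 ≤ t - s := by linarith
  calc _ ≤ ‖e t s - 1‖ * ‖e s 0‖ := norm_mul_le _ _
    _ ≤ (M * (t - s) ^ γ) * M := by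
        have := h.nonneg
        gcongr
        · exact h.norm_sub_one_le s t hs hst htS h1
        · exact h.norm_le 0 s le_rfl hs (hst.trans htS)
    _ = _ := by ring

theorem intervalIntegrable_mul (h : IsRoughFlowOn γ S M A1 A2 e) (hγ : 0 < γ)
    (hφ : IntervalIntegrable φ MeasureTheory.volume 0 S) {a b t : ℝ} (ha : 0 ≤ a) (hab : a ≤ b)
    (hbt : b ≤ t) (ht : t ≤ S) :
    IntervalIntegrable (fun r => e t r * φ r) MeasureTheory.volume a b := by
  refine (hφ.mono_set ?_).continuousOn_mul ((h.continuousOn_right hγ ht).mono ?_)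
  · rw [Set.uIcc_of_le hab, Set.uIcc_of_le (by linarith)]
    exact Set.Icc_subset_Icc ha (hbt.trans ht)
  · rw [Set.uIcc_of_le hab]
    exact Set.Icc_subset_Icc ha hbt

variable [NormedAlgebra ℝ A]

theorem norm_integral_sub_le (h : IsRoughFlowOn γ S M A1 A2 e) (hγ : 0 < γ) (hγ2 : γ ≤ 1 / 2)
    (hφ : IntervalIntegrable φ MeasureTheory.volume 0 S)
    (hP : ∀ r, 0 ≤ r → r ≤ S → ‖φ r‖ ≤ P) {s t : ℝ} (hs : 0 ≤ s) (hst : s ≤ t) (ht : t ≤ S)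
    (h1 : t - s ≤ 1) :
    ‖(∫ r in s..t, e t r * φ r) - ∫ r in s..t, φ r‖ ≤ M * P * (t - s) ^ (3 * γ) := by
  have hφ' : IntervalIntegrable φ MeasureTheory.volume s t := hφ.mono_set (by
    rw [Set.uIcc_of_le hst, Set.uIcc_of_le (by linarith)]
    exact Set.Icc_subset_Icc hs ht)
  have hM := h.nonneg
  have hP0 : 0 ≤ P := (norm_nonneg _).trans (hP s hs (hst.trans ht))
  have hts : 0 ≤ t - s := by linarith
  rw [← intervalIntegral.integral_sub (h.intervalIntegrable_mul hγ hφ hs hst le_rfl ht) hφ']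
  have hbound : ∀ r ∈ Set.uIoc s t, ‖e t r * φ r - φ r‖ ≤ M * P * (t - s) ^ γ := by
    intro r hr
    rw [Set.uIoc_of_le hst] at hr
    have hr0 : 0 ≤ r := hs.trans hr.1.le
    have htr : 0 ≤ t - r := by linarith [hr.2]
    have : e t r * φ r - φ r = (e t r - 1) * φ r := by noncomm_ring
    rw [this]
    calc _ ≤ ‖e t r - 1‖ * ‖φ r‖ := norm_mul_le _ _
      _ ≤ (M * (t - r) ^ γ) * P := by
          gcongr
          · exact h.norm_sub_one_le r t hr0 hr.2 ht (by linarith [hr.1])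
          · exact hP r hr0 (hr.2.trans ht)
      _ ≤ (M * (t - s) ^ γ) * P := by gcongr; exact hr.1.le
      _ = _ := by ring
  refine (intervalIntegral.norm_integral_le_of_norm_le_const hbound).trans ?_
  rw [abs_of_nonneg hts, mul_assoc (M * P)]
  gcongr
  rcases hts.eq_or_lt with h0 | h0
  · rw [← h0]; simp; positivity
  · rw [← Real.rpow_add_one h0.ne']
    exact Real.rpow_le_rpow_of_exponent_ge h0 h1 (by linarith)

theorem norm_duhamelDefect_sub_le (h : IsRoughFlowOn γ S M A1 A2 e) (hγ : 0 < γ)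
    (hγ2 : γ ≤ 1 / 2) (hφ : IntervalIntegrable φ MeasureTheory.volume 0 S)
    (hP : ∀ r, 0 ≤ r → r ≤ S → ‖φ r‖ ≤ P) {Q : ℝ} (hQ : ∀ r, 0 ≤ r → r ≤ S → ‖f r‖ ≤ Q)
    {s t : ℝ} (hs : 0 ≤ s) (hst : s ≤ t) (ht : t ≤ S) (h1 : t - s ≤ 1) :
    ‖duhamelDefect e φ f t s - (f t - f s - (∫ r in s..t, φ r) - (A1 t s + A2 t s) * f s)‖ ≤
      (M * P + M * Q) * (t - s) ^ (3 * γ) := by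
  have hM := h.nonneg
  have hts : 0 ≤ t - s := by linarith
  have : duhamelDefect e φ f t s -
      (f t - f s - (∫ r in s..t, φ r) - (A1 t s + A2 t s) * f s) =
      -((∫ r in s..t, e t r * φ r) - ∫ r in s..t, φ r) -
        (e t s - 1 - (A1 t s + A2 t s)) * f s := by
    simp only [duhamelDefect]; noncomm_ring
  rw [this]
  calc _ ≤ ‖(∫ r in s..t, e t r * φ r) - ∫ r in s..t, φ r‖ +
        ‖e t s - 1 - (A1 t s + A2 t s)‖ * ‖f s‖ := by
        refine (norm_sub_le _ _).trans ?_
        rw [norm_neg]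
        gcongr
        exact norm_mul_le _ _
    _ ≤ M * P * (t - s) ^ (3 * γ) + M * (t - s) ^ (3 * γ) * Q := by
        gcongr
        · exact h.norm_integral_sub_le hγ hγ2 hφ hP hs hst ht h1
        · exact h.remainder_le s t hs hst ht h1
        · exact hQ s hs (hst.trans ht)
    _ = _ := by ring

variable [CompleteSpace A]

theorem integral_comp (h : IsRoughFlowOn γ S M A1 A2 e) (hγ : 0 < γ)
    (hφ : IntervalIntegrable φ MeasureTheory.volume 0 S) {a u t : ℝ} (ha : 0 ≤ a) (hau : a ≤ u)
    (hut : u ≤ t) (ht : t ≤ S) :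
    ∫ r in a..u, e t r * φ r = e t u * ∫ r in a..u, e u r * φ r := by
  rw [← ContinuousLinearMap.mul_apply' ℝ A, ← ContinuousLinearMap.intervalIntegral_comp_comm _
    (h.intervalIntegrable_mul hγ hφ ha hau le_rfl (hut.trans ht))]
  refine intervalIntegral.integral_congr fun r hr => ?_
  rw [Set.uIcc_of_le hau] at hr
  simp only [ContinuousLinearMap.mul_apply']
  rw [h.comp r u t (ha.trans hr.1) hr.2 hut ht, mul_assoc]

theorem duhamelDefect_add (h : IsRoughFlowOn γ S M A1 A2 e) (hγ : 0 < γ)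
    (hφ : IntervalIntegrable φ MeasureTheory.volume 0 S) {s u t : ℝ} (hs : 0 ≤ s) (hsu : s ≤ u)
    (hut : u ≤ t) (ht : t ≤ S) :
    duhamelDefect e φ f t s = duhamelDefect e φ f t u + e t u * duhamelDefect e φ f u s := by
  have hint := intervalIntegral.integral_add_adjacent_intervals
    (h.intervalIntegrable_mul hγ hφ hs hsu hut ht)
    (h.intervalIntegrable_mul hγ hφ (hs.trans hsu) hut le_rfl ht)
  simp only [duhamelDefect]
  rw [← hint, h.integral_comp hγ hφ hs hsu hut ht, h.comp s u t hs hsu hut ht]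
  noncomm_ring

/-- A bounded path has a `3γ`-Hölder remainder if and only if it satisfies the Duhamel formula. -/
theorem remainder_le_iff_duhamelDefect_eq_zero (h : IsRoughFlowOn γ S M A1 A2 e)
    (hγ1 : 1 / 3 < γ) (hγ2 : γ ≤ 1 / 2) (hφ : IntervalIntegrable φ MeasureTheory.volume 0 S)
    (hP : ∀ r, 0 ≤ r → r ≤ S → ‖φ r‖ ≤ P) {Q : ℝ} (hQ : ∀ r, 0 ≤ r → r ≤ S → ‖f r‖ ≤ Q) :
    (∃ C : ℝ, ∀ s t : ℝ, 0 ≤ s → s ≤ t → t ≤ S → t - s ≤ 1 →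
      ‖f t - f s - (∫ r in s..t, φ r) - (A1 t s + A2 t s) * f s‖ ≤ C * (t - s) ^ (3 * γ)) ↔
    ∀ t, 0 ≤ t → t ≤ S → duhamelDefect e φ f t 0 = 0 := by
  have hγ : 0 < γ := by linarith
  constructor
  · rintro ⟨C, hC⟩ t ht htS
    have hconst : duhamelDefect e φ f t t = duhamelDefect e φ f t 0 := by
      refine eq_of_norm_sub_le_rpow (g := fun u => duhamelDefect e φ f t u)
        (C := M * (M * P + M * Q + C)) (β := 3 * γ) ht (by linarith)
        fun s u hs hsu hut h1 => ?_
      have huS := hut.trans htS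
      have hus : 0 ≤ u - s := by linarith
      have hd : ‖duhamelDefect e φ f u s‖ ≤ (M * P + M * Q + C) * (u - s) ^ (3 * γ) := by
        have h3 := norm_le_norm_add_norm_sub'
          (duhamelDefect e φ f u s)
          (f u - f s - (∫ r in s..u, φ r) - (A1 u s + A2 u s) * f s)
        have h4 := h.norm_duhamelDefect_sub_le hγ hγ2 hφ hP hQ hs hsu huS h1
        have h5 := hC s u hs hsu huS h1
        linarith
      rw [h.duhamelDefect_add hγ hφ hs hsu hut htS, norm_sub_rev, add_sub_cancel_left, mul_assoc]
      refine (norm_mul_le _ _).trans ?_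
      gcongr
      · exact h.nonneg
      · exact h.norm_le u t (hs.trans hsu) hut htS
    rw [← hconst]
    simp [duhamelDefect, h.refl t ht htS]
  · intro hD
    refine ⟨M * P + M * Q, fun s t hs hst htS h1 => ?_⟩
    have h0 := h.duhamelDefect_add (f := f) hγ hφ le_rfl hs hst htS
    rw [hD t (hs.trans hst) htS, hD s hs (hst.trans htS), mul_zero, add_zero] at h0
    have := h.norm_duhamelDefect_sub_le hγ hγ2 hφ hP hQ hs hst htS h1
    rwa [← h0, zero_sub, norm_neg] at this

end IsRoughFlowOn

/-- The Volterra operator of the Duhamel formula. -/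
noncomputable def duhamelIntegral {A : Type} [NormedRing A] [NormedAlgebra ℝ A]
    (e : ℝ → ℝ → A) (B g : ℝ → A) (t : ℝ) : A :=
  ∫ r in (0 : ℝ)..t, e t r * (B r * g r)

/-- The terms of the Picard series solving the Duhamel formula. -/
noncomputable def picardTerm {A : Type} [NormedRing A] [NormedAlgebra ℝ A]
    (e : ℝ → ℝ → A) (B : ℝ → A) (f₀ : A) : ℕ → ℝ → A
  | 0 => fun t => e t 0 * f₀
  | n + 1 => duhamelIntegral e B (picardTerm e B f₀ n)

theorem intervalIntegrable_mul_of_bounded {A : Type} [NormedRing A] {B g : ℝ → A} {KB a b : ℝ}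
    (hB : MeasureTheory.StronglyMeasurable B) (hKB : ∀ r, ‖B r‖ ≤ KB) (hab : a ≤ b)
    (hg : ContinuousOn g (Set.Icc a b)) :
    IntervalIntegrable (fun r => B r * g r) MeasureTheory.volume a b := by
  refine IntervalIntegrable.mul_continuousOn ?_ (by rwa [Set.uIcc_of_le hab])
  exact (intervalIntegrable_const (c := KB)).mono_fun' hB.aestronglyMeasurable
    (Filter.Eventually.of_forall hKB)

namespace IsRoughFlowOn

variable {A : Type} [NormedRing A] {γ S M KB P : ℝ} {A1 A2 e : ℝ → ℝ → A}
  {B g : ℝ → A}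

theorem norm_kernel_mul_le (h : IsRoughFlowOn γ S M A1 A2 e) (hKB : ∀ r, ‖B r‖ ≤ KB) {r t : ℝ}
    (hr : 0 ≤ r) (hrt : r ≤ t) (ht : t ≤ S) : ‖e t r * (B r * g r)‖ ≤ M * KB * ‖g r‖ := by
  have hM := h.nonneg
  calc _ ≤ ‖e t r‖ * (‖B r‖ * ‖g r‖) :=
        (norm_mul_le _ _).trans (by gcongr; exact norm_mul_le _ _)
    _ ≤ M * (KB * ‖g r‖) := by
        gcongr
        · exact h.norm_le r t hr hrt ht
        · exact hKB r
    _ = _ := by ring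

variable [NormedAlgebra ℝ A]

theorem norm_duhamelIntegral_le (h : IsRoughFlowOn γ S M A1 A2 e)
    (hKB : ∀ r, ‖B r‖ ≤ KB) {n : ℕ}
    (hg : ∀ r, 0 ≤ r → r ≤ S → ‖g r‖ ≤ P * ((M * KB * r) ^ n / n.factorial)) {t : ℝ}
    (ht : 0 ≤ t) (htS : t ≤ S) :
    ‖duhamelIntegral e B g t‖ ≤ P * ((M * KB * t) ^ (n + 1) / (n + 1).factorial) := by
  have hM := h.nonneg
  have hKB0 : 0 ≤ KB := (norm_nonneg _).trans (hKB 0)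
  have hle : ‖duhamelIntegral e B g t‖ ≤
      ∫ r in (0 : ℝ)..t, M * KB * (P * ((M * KB) ^ n / n.factorial)) * r ^ n := by
    refine intervalIntegral.norm_integral_le_of_norm_le ht
      (Filter.Eventually.of_forall fun r hr => ?_) (Continuous.intervalIntegrable (by fun_prop) _ _)
    have hr0 : 0 ≤ r := hr.1.le
    refine (h.norm_kernel_mul_le hKB hr0 hr.2 htS).trans ?_
    have := hg r hr0 (hr.2.trans htS)
    calc M * KB * ‖g r‖ ≤ M * KB * (P * ((M * KB * r) ^ n / n.factorial)) := by gcongr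
      _ = _ := by rw [mul_pow]; ring
  refine hle.trans (le_of_eq ?_)
  rw [intervalIntegral.integral_const_mul, integral_pow, Nat.factorial_succ]
  push_cast
  have : (n.factorial : ℝ) ≠ 0 := by positivity
  have : (n : ℝ) + 1 ≠ 0 := by positivity
  rw [zero_pow (by omega)]
  field_simp
  ring

/-- The homogeneous Volterra equation has only the zero solution. -/
theorem eq_zero_of_eq_duhamelIntegral (h : IsRoughFlowOn γ S M A1 A2 e)
    (hKB : ∀ r, ‖B r‖ ≤ KB) (hg : ContinuousOn g (Set.Icc 0 S))
    (heq : ∀ t, 0 ≤ t → t ≤ S → g t = duhamelIntegral e B g t) {t : ℝ} (ht : 0 ≤ t)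
    (htS : t ≤ S) : g t = 0 := by
  obtain ⟨P, hP⟩ := isCompact_Icc.exists_bound_of_continuousOn hg
  have hn : ∀ (n : ℕ) t, 0 ≤ t → t ≤ S → ‖g t‖ ≤ P * ((M * KB * t) ^ n / n.factorial) := by
    intro n
    induction n with
    | zero => intro t ht htS; simpa using hP t ⟨ht, htS⟩
    | succ n ih =>
      intro t ht htS
      rw [heq t ht htS]
      exact h.norm_duhamelIntegral_le hKB ih ht htS
  have hlim := (FloorSemiring.tendsto_pow_div_factorial_atTop (M * KB * t)).const_mul P
  rw [mul_zero] at hlim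
  exact norm_le_zero_iff.1 (ge_of_tendsto' hlim fun n => hn n t ht htS)

variable [CompleteSpace A]

theorem continuousOn_duhamelIntegral (h : IsRoughFlowOn γ S M A1 A2 e) (hγ : 0 < γ)
    (hγ1 : γ ≤ 1) (hS : 0 ≤ S)
    (hB : MeasureTheory.StronglyMeasurable B) (hKB : ∀ r, ‖B r‖ ≤ KB)
    (hg : ContinuousOn g (Set.Icc 0 S)) :
    ContinuousOn (duhamelIntegral e B g) (Set.Icc 0 S) := by
  have hM := h.nonneg
  have hKB0 : 0 ≤ KB := (norm_nonneg _).trans (hKB 0)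
  obtain ⟨P, hP⟩ := isCompact_Icc.exists_bound_of_continuousOn hg
  have hP0 : 0 ≤ P := (norm_nonneg _).trans (hP 0 ⟨le_rfl, hS⟩)
  have hφ := intervalIntegrable_mul_of_bounded hB hKB hS hg
  have hk : ∀ a b t, 0 ≤ a → a ≤ b → b ≤ t → t ≤ S →
      ‖∫ r in a..b, e t r * (B r * g r)‖ ≤ M * KB * P * (b - a) := by
    intro a b t ha hab hbt htS
    have := intervalIntegral.norm_integral_le_of_norm_le_const
      (f := fun r => e t r * (B r * g r)) (a := a) (b := b) (C := M * KB * P) fun r hr => by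
        rw [Set.uIoc_of_le hab] at hr
        have hr0 := ha.trans hr.1.le
        refine (h.norm_kernel_mul_le hKB hr0 (hr.2.trans hbt) htS).trans ?_
        gcongr
        exact hP r ⟨hr0, hr.2.trans (hbt.trans htS)⟩
    rwa [abs_of_nonneg (by linarith)] at this
  refine continuousOn_Icc_of_norm_sub_le (C := M * (M * KB * P * S) + M * KB * P) hγ
    fun s t hs hst htS h1 => ?_
  have hts : 0 ≤ t - s := by linarith
  have heq : duhamelIntegral e B g t - duhamelIntegral e B g s =
      (e t s - 1) * duhamelIntegral e B g s + ∫ r in s..t, e t r * (B r * g r) := by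
    have hadd := intervalIntegral.integral_add_adjacent_intervals
      (h.intervalIntegrable_mul hγ hφ le_rfl hs hst htS)
      (h.intervalIntegrable_mul hγ hφ hs hst le_rfl htS)
    simp only [duhamelIntegral]
    rw [← hadd, h.integral_comp hγ hφ le_rfl hs hst htS]
    noncomm_ring
  rw [heq]
  calc _ ≤ ‖e t s - 1‖ * ‖duhamelIntegral e B g s‖ + ‖∫ r in s..t, e t r * (B r * g r)‖ :=
        (norm_add_le _ _).trans (by gcongr; exact norm_mul_le _ _)
    _ ≤ (M * (t - s) ^ γ) * (M * KB * P * S) + M * KB * P * (t - s) := by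
        gcongr
        · exact h.norm_sub_one_le s t hs hst htS h1
        · refine (hk 0 s s le_rfl hs le_rfl (hst.trans htS)).trans ?_
          gcongr
          linarith
        · exact hk s t t hs hst le_rfl htS
    _ ≤ (M * (t - s) ^ γ) * (M * KB * P * S) + M * KB * P * (t - s) ^ γ := by
        gcongr
        exact Real.self_le_rpow_of_le_one hts h1 hγ1
    _ = _ := by ring

/-- The Picard series is continuous and solves the Duhamel formula. -/
theorem picard_series_solves (h : IsRoughFlowOn γ S M A1 A2 e) (hγ : 0 < γ)
    (hγ1 : γ ≤ 1) (hS : 0 ≤ S)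
    (hB : MeasureTheory.StronglyMeasurable B) (hKB : ∀ r, ‖B r‖ ≤ KB) (f₀ : A) :
    ContinuousOn (fun t => ∑' n, picardTerm e B f₀ n t) (Set.Icc 0 S) ∧
    ∀ t, 0 ≤ t → t ≤ S → ∑' n, picardTerm e B f₀ n t =
      e t 0 * f₀ + ∫ r in (0 : ℝ)..t, e t r * (B r * ∑' n, picardTerm e B f₀ n r) := by
  have hM := h.nonneg
  have hKB0 : 0 ≤ KB := (norm_nonneg _).trans (hKB 0)
  have hcont : ∀ n, ContinuousOn (picardTerm e B f₀ n) (Set.Icc 0 S) := by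
    intro n
    induction n with
    | zero => exact (h.continuousOn_left hγ).mul continuousOn_const
    | succ n ih => exact h.continuousOn_duhamelIntegral hγ hγ1 hS hB hKB ih
  have hbound : ∀ n t, 0 ≤ t → t ≤ S →
      ‖picardTerm e B f₀ n t‖ ≤ M * ‖f₀‖ * ((M * KB * t) ^ n / n.factorial) := by
    intro n
    induction n with
    | zero =>
      intro t ht htS
      simp only [pow_zero, Nat.factorial_zero, Nat.cast_one, div_one, mul_one]
      refine (norm_mul_le _ _).trans ?_
      gcongr
      exact h.norm_le 0 t le_rfl ht htS
    | succ n ih =>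
      intro t ht htS
      exact h.norm_duhamelIntegral_le hKB ih ht htS
  have hbound' : ∀ n t, t ∈ Set.Icc 0 S →
      ‖picardTerm e B f₀ n t‖ ≤ M * ‖f₀‖ * ((M * KB * S) ^ n / n.factorial) := by
    intro n t ht
    refine (hbound n t ht.1 ht.2).trans ?_
    have := ht.1
    have := ht.2
    gcongr
  have hsum : Summable fun n : ℕ => M * ‖f₀‖ * ((M * KB * S) ^ n / n.factorial) :=
    (Real.summable_pow_div_factorial _).mul_left _
  have hsummable : ∀ t ∈ Set.Icc 0 S, Summable fun n => picardTerm e B f₀ n t := fun t ht =>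
    Summable.of_norm_bounded hsum fun n => hbound' n t ht
  refine ⟨continuousOn_tsum hcont hsum hbound', fun t ht htS => ?_⟩
  rw [(hsummable t ⟨ht, htS⟩).tsum_eq_zero_add]
  refine congrArg (e t 0 * f₀ + ·) (HasSum.tsum_eq ?_)
  refine intervalIntegral.hasSum_integral_of_dominated_convergence
    (fun n _ => M * KB * (M * ‖f₀‖ * ((M * KB * S) ^ n / n.factorial))) ?_ ?_ ?_ ?_ ?_
  · intro n
    have hφ := intervalIntegrable_mul_of_bounded hB hKB hS (hcont n)
    exact (h.intervalIntegrable_mul hγ hφ le_rfl ht le_rfl htS).def'.aestronglyMeasurable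
  · refine fun n => Filter.Eventually.of_forall fun r hr => ?_
    rw [Set.uIoc_of_le ht] at hr
    refine (h.norm_kernel_mul_le hKB hr.1.le hr.2 htS).trans ?_
    gcongr
    exact hbound' n r ⟨hr.1.le, hr.2.trans htS⟩
  · exact Filter.Eventually.of_forall fun r _ => hsum.mul_left _
  · exact intervalIntegrable_const
  · refine Filter.Eventually.of_forall fun r hr => ?_
    rw [Set.uIoc_of_le ht] at hr
    exact ((hsummable r ⟨hr.1.le, hr.2.trans htS⟩).hasSum.mul_left _).mul_left _

end IsRoughFlowOn

theorem drift_solution_exists_unique_and_duhamel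
    (γ : ℝ) (hγ1 : 1 / 3 < γ) (hγ2 : γ ≤ 1 / 2)
    (A : Type) [NormedRing A] [NormedAlgebra ℝ A] [CompleteSpace A]
    [MeasurableSpace A] [BorelSpace A]
    (T : EReal) (hT : 0 < T)
    (A1 A2 : ℝ → ℝ → A)
    (hChen : ChenRelations T A1 A2)
    (hNorm : ∃ K : ℝ, DriverNormBound γ T A1 A2 K)
    (B : ℝ → A) (hBmeas : Measurable B) (hBbdd : ∃ KB : ℝ, ∀ r : ℝ, ‖B r‖ ≤ KB)
    -- the two-parameter flow generated by 𝐀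
    (e : ℝ → ℝ → A)
    (hinit : ∀ s : ℝ, 0 ≤ s → (s : EReal) < T → e s s = 1)
    (hHolder : ∀ s : ℝ, 0 ≤ s → (s : EReal) < T →
      LocallyHolderFrom γ s T (fun t u => e t s - e u s))
    (hRem : ∀ s : ℝ, 0 ≤ s → (s : EReal) < T →
      LocallyHolderFrom (3 * γ) s T
        (fun t u => e t s - e u s - (A1 t u + A2 t u) * e u s))
    (f₀ : A) :
    (∃ f : ℝ → A, f 0 = f₀ ∧ IsDriftSolution γ T A1 A2 B f ∧
      ∀ g : ℝ → A, g 0 = f₀ → IsDriftSolution γ T A1 A2 B g →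
        ∀ t : ℝ, 0 ≤ t → (t : EReal) < T → g t = f t) ∧
    (∀ f : ℝ → A, f 0 = f₀ →
      ContinuousOn f {t : ℝ | 0 ≤ t ∧ (t : EReal) < T} →
      (IsDriftSolution γ T A1 A2 B f ↔
        ∀ t : ℝ, 0 ≤ t → (t : EReal) < T →
          f t = e t 0 * f₀ + ∫ r in (0:ℝ)..t, e t r * (B r * f r))) := by
  obtain ⟨K', hK'⟩ := hNorm
  obtain ⟨KB, hKB⟩ := hBbdd
  have hB := hBmeas.stronglyMeasurable_of_standardBorel
  have hγ : 0 < γ := by linarith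
  have hK : DriverNormBound γ T A1 A2 (max K' 0) := fun s t hs hst htT h1 => by
    have hts : 0 ≤ t - s := by linarith
    obtain ⟨h₁, h₂⟩ := hK' s t hs hst htT h1
    exact ⟨h₁.trans (by gcongr; exact le_max_left _ _),
      h₂.trans (by gcongr; exact le_max_left _ _)⟩
  have hflow : ∀ S : ℝ, (S : EReal) < T → ∃ M, IsRoughFlowOn γ S M A1 A2 e := fun S hS =>
    exists_isRoughFlowOn hγ1 (le_max_right _ _) hChen hK hinit hRem hS
  have hIcc : ∀ S : ℝ, (S : EReal) < T → Set.Icc 0 S ⊆ {t : ℝ | 0 ≤ t ∧ (t : EReal) < T} :=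
    fun S hS t ht => ⟨ht.1, EReal.coe_lt_of_le_of_coe_lt ht.2 hS⟩
  have hbound : ∀ f : ℝ → A, ContinuousOn f {t : ℝ | 0 ≤ t ∧ (t : EReal) < T} →
      ∀ S : ℝ, 0 ≤ S → (S : EReal) < T →
      ((∃ C, ∀ s t, 0 ≤ s → s ≤ t → t ≤ S → t - s ≤ 1 →
        ‖f t - f s - (∫ r in s..t, B r * f r) - (A1 t s + A2 t s) * f s‖
          ≤ C * (t - s) ^ (3 * γ)) ↔
        ∀ t, 0 ≤ t → t ≤ S → duhamelDefect e (fun r => B r * f r) f t 0 = 0) := by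
    intro f hf S hS0 hS
    obtain ⟨M, hM⟩ := hflow S hS
    have hfS := hf.mono (hIcc S hS)
    obtain ⟨Q, hQ⟩ := isCompact_Icc.exists_bound_of_continuousOn hfS
    have hKB0 : 0 ≤ KB := (norm_nonneg _).trans (hKB 0)
    refine hM.remainder_le_iff_duhamelDefect_eq_zero (P := KB * Q) (Q := Q) hγ1 hγ2
      (intervalIntegrable_mul_of_bounded hB hKB hS0 hfS) (fun r hr hrS => ?_)
      fun r hr hrS => hQ r ⟨hr, hrS⟩
    refine (norm_mul_le _ _).trans ?_
    gcongr
    · exact hKB r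
    · exact hQ r ⟨hr, hrS⟩
  have key : ∀ f : ℝ → A, f 0 = f₀ →
      ContinuousOn f {t : ℝ | 0 ≤ t ∧ (t : EReal) < T} →
      (IsDriftSolution γ T A1 A2 B f ↔
        ∀ t : ℝ, 0 ≤ t → (t : EReal) < T →
          f t = e t 0 * f₀ + ∫ r in (0:ℝ)..t, e t r * (B r * f r)) := by
    intro f hf0 hf
    have hdef : ∀ t, duhamelDefect e (fun r => B r * f r) f t 0 = 0 ↔
        f t = e t 0 * f₀ + ∫ r in (0:ℝ)..t, e t r * (B r * f r) := fun t => by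
      rw [duhamelDefect, hf0, sub_sub, sub_eq_zero]
    constructor
    · rintro ⟨-, h⟩ t ht htT
      exact (hdef t).1 ((hbound f hf t ht htT).1 (h t htT) t ht le_rfl)
    · refine fun h => ⟨hf, fun S hS => ?_⟩
      rcases lt_or_ge S 0 with hS0 | hS0
      · exact ⟨0, fun s t hs hst htS _ => by linarith⟩
      · exact (hbound f hf S hS0 hS).2 fun t ht htS =>
          (hdef t).2 (h t ht (EReal.coe_lt_of_le_of_coe_lt htS hS))
  refine ⟨?_, key⟩
  have hsolve : ∀ S : ℝ, 0 ≤ S → (S : EReal) < T → _ := fun S hS0 hS =>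
    (hflow S hS).choose_spec.picard_series_solves hγ (by linarith) hS0 hB hKB f₀
  have hduh : ∀ t : ℝ, 0 ≤ t → (t : EReal) < T → _ := fun t ht htT =>
    (hsolve t ht htT).2 t ht le_rfl
  have hf0 : ∑' n, picardTerm e B f₀ n 0 = f₀ := by
    rw [hduh 0 le_rfl (by simpa using hT), hinit 0 le_rfl (by simpa using hT)]
    simp
  have hcont : ContinuousOn (fun t => ∑' n, picardTerm e B f₀ n t)
      {t : ℝ | 0 ≤ t ∧ (t : EReal) < T} := by
    rintro t ⟨ht, htT⟩
    obtain ⟨S, htS, hST⟩ := EReal.lt_iff_exists_real_btwn.1 htT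
    have htS' : t < S := EReal.coe_lt_coe_iff.1 htS
    refine ((hsolve S (ht.trans htS'.le) hST).1 t ⟨ht, htS'.le⟩).mono_of_mem_nhdsWithin ?_
    filter_upwards [self_mem_nhdsWithin, mem_nhdsWithin_of_mem_nhds (Iic_mem_nhds htS')]
      with r hr hrS using ⟨hr.1, hrS⟩
  refine ⟨_, hf0, (key _ hf0 hcont).2 hduh, fun g hg0 hg t ht htT => ?_⟩
  obtain ⟨M, hM⟩ := hflow t htT
  have hgt := hg.1.mono (hIcc t htT)
  have hft := hcont.mono (hIcc t htT)
  refine sub_eq_zero.1 (hM.eq_zero_of_eq_duhamelIntegral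
    (g := fun r => g r - ∑' n, picardTerm e B f₀ n r) hKB (hgt.sub hft)
    (fun s hs hst => ?_) ht le_rfl)
  have hsT := EReal.coe_lt_of_le_of_coe_lt hst htT
  have hint : ∀ u : ℝ → A, ContinuousOn u (Set.Icc 0 t) →
      IntervalIntegrable (fun r => e s r * (B r * u r)) MeasureTheory.volume 0 s := fun u hu =>
    hM.intervalIntegrable_mul hγ (intervalIntegrable_mul_of_bounded hB hKB ht hu) le_rfl hs
      le_rfl hst
  simp only [duhamelIntegral, mul_sub]
  rw [intervalIntegral.integral_sub (hint g hgt) (hint _ hft), (key g hg0 hg.1).1 hg s hs hsT,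
    hduh s hs hsT]
  abel
end

section
/- Let 1/3 < γ ≤ 1/2, let 𝒜 be a Banach algebra with unit 1, T ∈ (0,∞], let 𝐀 = (A¹,A²) be a bounded γ-rough driver in 𝒜 on [0,T), and let (e^𝐀_{ts})_{s≤t} be the two-parameter flow generated by 𝐀 (e^𝐀_{ss} = 1, t ↦ e^𝐀_{ts} γ-Hölder on bounded intervals, and e^𝐀_{ts} − e^𝐀_{us} − (A¹_{tu}+A²_{tu}) e^𝐀_{us} locally 3γ-Hölder). Then there is a constant C, depending only on γ and ‖𝐀‖, such that |e^𝐀_{ts} − 1| ≤ C (t−s)^γ and |e^𝐀_{ts} − 1 − A¹_{ts} − A²_{ts}| ≤ C (t−s)^{3γ} for all 0 ≤ s ≤ t < T with t−s ≤ 1. -/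
/-- An a priori finite bound that can be improved to `q * M + d` with `q < 1` can be improved to
the fixed point `d / (1 - q)`. -/
theorem le_fixedPoint_of_self_improving {ι : Type*} {x w : ι → ℝ} {q d : ℝ}
    (hq0 : 0 ≤ q) (hq1 : q < 1) (hd : 0 ≤ d) (hw : ∀ i, 0 ≤ w i)
    (hbd : ∃ M, ∀ i, x i ≤ M * w i)
    (himp : ∀ M, 0 ≤ M → (∀ i, x i ≤ M * w i) → ∀ i, x i ≤ (q * M + d) * w i) (i : ι) :
    x i ≤ d / (1 - q) * w i := by
  obtain ⟨M, hM⟩ := hbd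
  have h1q : 0 < 1 - q := by linarith
  have hiter : ∀ n : ℕ, ∀ i, x i ≤ (d / (1 - q) + q ^ n * |M|) * w i := by
    intro n
    induction n with
    | zero =>
      intro i
      refine (hM i).trans (mul_le_mul_of_nonneg_right ?_ (hw i))
      have : 0 ≤ d / (1 - q) := by positivity
      linarith [le_abs_self M]
    | succ n ih =>
      intro i
      refine (himp _ (by positivity) ih i).trans_eq ?_
      field_simp
      ring
  have hlim : Filter.Tendsto (fun n : ℕ => (d / (1 - q) + q ^ n * |M|) * w i) Filter.atTop
      (nhds ((d / (1 - q) + 0 * |M|) * w i)) :=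
    (((tendsto_pow_atTop_nhds_zero_of_lt_one hq0 hq1).mul_const _).const_add _).mul_const _
  simpa using ge_of_tendsto' hlim fun n => hiter n i

theorem norm_mul_le_mul_one_add_norm_sub_one {A : Type*} [NormedRing A] {x y : A} {k G : ℝ}
    (hx : ‖x‖ ≤ k) (hy : ‖y - 1‖ ≤ G) : ‖x * y‖ ≤ k * (1 + G) := by
  have hk : 0 ≤ k := (norm_nonneg x).trans hx
  calc ‖x * y‖ = ‖x + x * (y - 1)‖ := by congr 1; noncomm_ring
    _ ≤ ‖x‖ + ‖x‖ * ‖y - 1‖ := (norm_add_le _ _).trans (by gcongr; exact norm_mul_le _ _)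
    _ ≤ k + k * G := by gcongr
    _ = k * (1 + G) := by ring

/-- The second order Taylor remainder of a path `f` driven by `(A1, A2)`. -/
def flowRemainder {A : Type} [NormedRing A] (A1 A2 : ℝ → ℝ → A) (f : ℝ → A) (t u : ℝ) : A :=
  f t - f u - (A1 t u + A2 t u) * f u

theorem rpow_two_mul_eq_sq {h : ℝ} (hh : 0 ≤ h) (γ : ℝ) : h ^ (2 * γ) = (h ^ γ) ^ 2 := by
  rw [mul_comm, Real.rpow_mul hh]; norm_cast

theorem rpow_three_mul_eq_cube {h : ℝ} (hh : 0 ≤ h) (γ : ℝ) : h ^ (3 * γ) = (h ^ γ) ^ 3 := by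
  rw [mul_comm, Real.rpow_mul hh]; norm_cast

theorem norm_sub_le_of_flowRemainder {A : Type} [NormedRing A] {A1 A2 : ℝ → ℝ → A} {f : ℝ → A}
    {u v k₁ k₂ G r : ℝ} (h₁ : ‖A1 v u‖ ≤ k₁) (h₂ : ‖A2 v u‖ ≤ k₂) (hG : ‖f u - 1‖ ≤ G)
    (hr : ‖flowRemainder A1 A2 f v u‖ ≤ r) :
    ‖f v - f u‖ ≤ (k₁ + k₂) * (1 + G) + r := by
  have h : f v - f u = (A1 v u + A2 v u) * f u + flowRemainder A1 A2 f v u := by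
    unfold flowRemainder; abel
  rw [h]
  exact (norm_add_le _ _).trans (add_le_add
    (norm_mul_le_mul_one_add_norm_sub_one ((norm_add_le _ _).trans (add_le_add h₁ h₂)) hG) hr)

theorem ChenRelations.flowRemainder_eq {A : Type} [NormedRing A] {T : EReal}
    {A1 A2 : ℝ → ℝ → A} (hA : ChenRelations T A1 A2) (f : ℝ → A) {u w v : ℝ}
    (hu : 0 ≤ u) (huw : u ≤ w) (hwv : w ≤ v) (hv : (v : EReal) < T) :
    flowRemainder A1 A2 f v u = flowRemainder A1 A2 f v w + flowRemainder A1 A2 f w u +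
      (A1 v w * (A2 w u * f u + flowRemainder A1 A2 f w u) + A2 v w * (f w - f u)) := by
  obtain ⟨h1, h2⟩ := hA u w v hu huw hwv hv
  unfold flowRemainder
  rw [h1, h2]
  noncomm_ring

/-- One step of the improvement of the constant in the remainder estimate, by halving. -/
theorem norm_flowRemainder_improve {A : Type} [NormedRing A] {T : EReal} {γ K : ℝ}
    (hγ : 0 ≤ γ) (hK : 0 ≤ K) {A1 A2 : ℝ → ℝ → A} (hA : ChenRelations T A1 A2)
    (hAK : DriverNormBound γ T A1 A2 K) {f : ℝ → A} {a b ε G L : ℝ} (ha : 0 ≤ a)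
    (hb : (b : EReal) < T) (hab1 : b - a ≤ 1) (habε : (b - a) ^ γ ≤ ε)
    (hG : ∀ u, a ≤ u → u ≤ b → ‖f u - 1‖ ≤ G) (hL0 : 0 ≤ L)
    (hL : ∀ u v, a ≤ u → u ≤ v → v ≤ b →
      ‖flowRemainder A1 A2 f v u‖ ≤ L * (v - u) ^ (3 * γ))
    {u v : ℝ} (hau : a ≤ u) (huv : u ≤ v) (hvb : v ≤ b) :
    ‖flowRemainder A1 A2 f v u‖ ≤
      (((2 : ℝ) ^ (1 - 3 * γ) + 2 * K * ε) * L + 3 * K ^ 2 * (1 + G)) * (v - u) ^ (3 * γ) := by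
  have hvT : (v : EReal) < T := lt_of_le_of_lt (EReal.coe_le_coe_iff.2 hvb) hb
  obtain ⟨w, hw⟩ : ∃ w, w = (u + v) / 2 := ⟨_, rfl⟩
  have huw : u ≤ w := by linarith
  have hwv : w ≤ v := by linarith
  have hwT : (w : EReal) < T := lt_of_le_of_lt (EReal.coe_le_coe_iff.2 hwv) hvT
  have hh0 : 0 ≤ v - u := by linarith
  have hhalf : ((v - u) / 2) ^ (3 * γ) * 2 = 2 ^ (1 - 3 * γ) * (v - u) ^ (3 * γ) := by
    rw [Real.div_rpow hh0 (by norm_num), Real.rpow_sub (by norm_num), Real.rpow_one]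
    ring
  have hvw : v - w = (v - u) / 2 := by rw [hw]; ring
  have hwu : w - u = (v - u) / 2 := by rw [hw]; ring
  obtain ⟨p, hp⟩ : ∃ p, p = (v - u) ^ γ := ⟨_, rfl⟩
  have hp0 : 0 ≤ p := hp ▸ Real.rpow_nonneg hh0 γ
  have hpε : p ≤ ε := by
    rw [hp]; exact (Real.rpow_le_rpow hh0 (by linarith) hγ).trans habε
  have hp1 : p ≤ 1 := by rw [hp]; exact Real.rpow_le_one hh0 (by linarith) hγ
  have hε0 : 0 ≤ ε := hp0.trans hpε
  have hkp : ((v - u) / 2) ^ γ ≤ p := by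
    rw [hp]; exact Real.rpow_le_rpow (by linarith) (by linarith) hγ
  have hk0 : 0 ≤ ((v - u) / 2) ^ γ := Real.rpow_nonneg (by linarith) γ
  have hG0 : 0 ≤ G := (norm_nonneg _).trans (hG u hau (huv.trans hvb))
  obtain ⟨b1, b2⟩ := hAK w v (by linarith) hwv hvT (by linarith)
  obtain ⟨c1, c2⟩ := hAK u w (by linarith) huw hwT (by linarith)
  have r1 := hL w v (by linarith) hwv hvb
  have r2 := hL u w hau huw (by linarith)
  rw [hvw] at b1 b2 r1
  rw [hwu] at c1 c2 r2
  have r3 : ‖flowRemainder A1 A2 f w u‖ ≤ L * p ^ 3 := by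
    refine r2.trans ?_
    rw [rpow_three_mul_eq_cube (by linarith)]
    gcongr
  rw [rpow_two_mul_eq_sq (by linarith)] at b2 c2
  replace b1 : ‖A1 v w‖ ≤ K * p := b1.trans (by gcongr)
  replace c1 : ‖A1 w u‖ ≤ K * p := c1.trans (by gcongr)
  replace b2 : ‖A2 v w‖ ≤ K * p ^ 2 := b2.trans (by gcongr)
  replace c2 : ‖A2 w u‖ ≤ K * p ^ 2 := c2.trans (by gcongr)
  have hfu := hG u hau (huv.trans hvb)
  have e1 := norm_sub_le_of_flowRemainder c1 c2 hfu r3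
  have e2 := norm_mul_le_mul_one_add_norm_sub_one c2 hfu
  have hcross : K * p * (K * p ^ 2 * (1 + G) + L * p ^ 3) +
      K * p ^ 2 * ((K * p + K * p ^ 2) * (1 + G) + L * p ^ 3) ≤
      (2 * K * ε * L + 3 * K ^ 2 * (1 + G)) * p ^ 3 := by
    have i1 : K ^ 2 * (1 + G) * p ^ 3 * p ≤ K ^ 2 * (1 + G) * p ^ 3 * 1 := by gcongr
    have i2 : K * L * p ^ 3 * p ≤ K * L * p ^ 3 * ε := by gcongr
    have i3 : K * L * p ^ 3 * p * p ≤ K * L * p ^ 3 * ε * 1 := by gcongr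
    linarith
  rw [hA.flowRemainder_eq f (by linarith) huw hwv hvT]
  calc _ ≤ ‖flowRemainder A1 A2 f v w‖ + ‖flowRemainder A1 A2 f w u‖ +
        (‖A1 v w‖ * (‖A2 w u * f u‖ + ‖flowRemainder A1 A2 f w u‖) +
          ‖A2 v w‖ * ‖f w - f u‖) := by
        refine (norm_add_le _ _).trans (add_le_add (norm_add_le _ _) ?_)
        refine (norm_add_le _ _).trans (add_le_add ?_ (norm_mul_le _ _))
        refine (norm_mul_le _ _).trans ?_
        gcongr
        exact norm_add_le _ _
    _ ≤ L * ((v - u) / 2) ^ (3 * γ) + L * ((v - u) / 2) ^ (3 * γ) +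
        (K * p * (K * p ^ 2 * (1 + G) + L * p ^ 3) +
          K * p ^ 2 * ((K * p + K * p ^ 2) * (1 + G) + L * p ^ 3)) := by gcongr
    _ ≤ L * (2 ^ (1 - 3 * γ) * (v - u) ^ (3 * γ)) +
        (2 * K * ε * L + 3 * K ^ 2 * (1 + G)) * p ^ 3 := by
        rw [← hhalf]; linarith
    _ = _ := by rw [rpow_three_mul_eq_cube hh0, ← hp]; ring

/-- Sewing estimate on a short interval: the remainder is controlled by the size of the path. -/
theorem norm_flowRemainder_le_of_short {A : Type} [NormedRing A] {T : EReal} {γ K θ : ℝ}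
    (hγ : 0 ≤ γ) (hK : 0 ≤ K) (hθ0 : 0 < θ) (hθ : (2 : ℝ) ^ (1 - 3 * γ) = 1 - θ)
    {A1 A2 : ℝ → ℝ → A} (hA : ChenRelations T A1 A2)
    (hAK : DriverNormBound γ T A1 A2 K) {f : ℝ → A} {a b ε G : ℝ} (ha : 0 ≤ a)
    (hb : (b : EReal) < T) (hab1 : b - a ≤ 1) (habε : (b - a) ^ γ ≤ ε)
    (hKε : 2 * K * ε ≤ θ / 2) (hG0 : 0 ≤ G)
    (hG : ∀ u, a ≤ u → u ≤ b → ‖f u - 1‖ ≤ G)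
    (hL : ∃ L, ∀ u v, a ≤ u → u ≤ v → v ≤ b →
      ‖flowRemainder A1 A2 f v u‖ ≤ L * (v - u) ^ (3 * γ))
    {u v : ℝ} (hau : a ≤ u) (huv : u ≤ v) (hvb : v ≤ b) :
    ‖flowRemainder A1 A2 f v u‖ ≤ 6 * K ^ 2 / θ * (1 + G) * (v - u) ^ (3 * γ) := by
  have hθ1 : θ < 1 := by
    have : (0 : ℝ) < 2 ^ (1 - 3 * γ) := by positivity
    linarith
  have key := le_fixedPoint_of_self_improving
    (ι := {z : ℝ × ℝ // a ≤ z.1 ∧ z.1 ≤ z.2 ∧ z.2 ≤ b})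
    (x := fun z => ‖flowRemainder A1 A2 f z.1.2 z.1.1‖)
    (w := fun z => (z.1.2 - z.1.1) ^ (3 * γ)) (q := 1 - θ / 2) (d := 3 * K ^ 2 * (1 + G))
    (by linarith) (by linarith) (by positivity)
    (fun z => Real.rpow_nonneg (sub_nonneg.2 z.2.2.1) _)
    (hL.imp fun L h z => h _ _ z.2.1 z.2.2.1 z.2.2.2)
    (fun L hL0 h z => by
      refine (norm_flowRemainder_improve hγ hK hA hAK ha hb hab1 habε hG hL0
        (fun u v h1 h2 h3 => h ⟨(u, v), h1, h2, h3⟩) z.2.1 z.2.2.1 z.2.2.2).trans ?_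
      have := Real.rpow_nonneg (sub_nonneg.2 z.2.2.1) (3 * γ)
      gcongr
      linarith)
    ⟨(u, v), hau, huv, hvb⟩
  refine key.trans_eq ?_
  have : 1 - (1 - θ / 2) = θ / 2 := by ring
  rw [this]
  field_simp
  ring

/-- Growth estimate on a short interval. -/
theorem norm_sub_one_le_of_short {A : Type} [NormedRing A] {T : EReal} {γ K θ : ℝ}
    (hγ : 0 ≤ γ) (hK : 0 ≤ K) (hθ0 : 0 < θ) (hθ : (2 : ℝ) ^ (1 - 3 * γ) = 1 - θ)
    {A1 A2 : ℝ → ℝ → A} (hA : ChenRelations T A1 A2)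
    (hAK : DriverNormBound γ T A1 A2 K) {f : ℝ → A} {a b ε : ℝ} (ha : 0 ≤ a)
    (hb : (b : EReal) < T) (hab1 : b - a ≤ 1) (habε : (b - a) ^ γ ≤ ε)
    (hKε : 2 * K * ε ≤ θ / 2) (hcε : (2 * K + 6 * K ^ 2 / θ) * ε ≤ 1 / 2)
    (hM : ∃ M, ∀ u, a ≤ u → u ≤ b → ‖f u - 1‖ ≤ M)
    (hL : ∃ L, ∀ u v, a ≤ u → u ≤ v → v ≤ b →
      ‖flowRemainder A1 A2 f v u‖ ≤ L * (v - u) ^ (3 * γ))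
    {u : ℝ} (hau : a ≤ u) (hub : u ≤ b) :
    ‖f u - 1‖ ≤ 2 * ‖f a - 1‖ + 1 := by
  have key := le_fixedPoint_of_self_improving (ι := {z : ℝ // a ≤ z ∧ z ≤ b})
    (x := fun z => ‖f z - 1‖) (w := fun _ => 1) (q := 1 / 2) (d := ‖f a - 1‖ + 1 / 2)
    (by norm_num) (by norm_num) (by positivity) (fun _ => zero_le_one)
    (hM.imp fun M h z => by simpa using h _ z.2.1 z.2.2)
    (fun G hG0 h z => by
      obtain ⟨z, haz, hzb⟩ := z
      have hG : ∀ u, a ≤ u → u ≤ b → ‖f u - 1‖ ≤ G :=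
        fun u h1 h2 => by simpa using h ⟨u, h1, h2⟩
      have hr := norm_flowRemainder_le_of_short hγ hK hθ0 hθ hA hAK ha hb hab1 habε hKε hG0 hG hL
        le_rfl haz hzb
      have hh0 : 0 ≤ z - a := by linarith
      obtain ⟨h1, h2⟩ := hAK a z ha haz (lt_of_le_of_lt (EReal.coe_le_coe_iff.2 hzb) hb)
        (by linarith)
      have hd := norm_sub_le_of_flowRemainder h1 h2 (hG a le_rfl (haz.trans hzb)) hr
      rw [rpow_two_mul_eq_sq hh0, rpow_three_mul_eq_cube hh0] at hd
      obtain ⟨p, hp⟩ : ∃ p, p = (z - a) ^ γ := ⟨_, rfl⟩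
      have hp0 : 0 ≤ p := hp ▸ Real.rpow_nonneg hh0 γ
      have hpε : p ≤ ε := by
        rw [hp]; exact (Real.rpow_le_rpow hh0 (by linarith) hγ).trans habε
      have hp1 : p ≤ 1 := by rw [hp]; exact Real.rpow_le_one hh0 (by linarith) hγ
      rw [← hp] at hd
      have hp2 : p ^ 2 ≤ p := pow_le_of_le_one hp0 hp1 (by norm_num)
      have hp3 : p ^ 3 ≤ p := pow_le_of_le_one hp0 hp1 (by norm_num)
      have hd' : ‖f z - f a‖ ≤ 1 / 2 * (1 + G) :=
        calc ‖f z - f a‖ ≤ _ := hd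
          _ ≤ (K * p + K * p) * (1 + G) + 6 * K ^ 2 / θ * (1 + G) * p := by gcongr
          _ = (2 * K + 6 * K ^ 2 / θ) * p * (1 + G) := by ring
          _ ≤ (2 * K + 6 * K ^ 2 / θ) * ε * (1 + G) := by gcongr
          _ ≤ _ := by gcongr
      have := norm_sub_le_norm_sub_add_norm_sub (f z) (f a) 1
      linarith)
    ⟨u, hau, hub⟩
  refine key.trans_eq ?_
  ring

/-- Iterating the growth estimate over intervals of length `H`. -/
theorem one_add_norm_sub_one_le_two_pow {A : Type} [NormedRing A] {T : EReal} {γ K θ : ℝ}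
    (hγ : 0 ≤ γ) (hK : 0 ≤ K) (hθ0 : 0 < θ) (hθ : (2 : ℝ) ^ (1 - 3 * γ) = 1 - θ)
    {A1 A2 : ℝ → ℝ → A} (hA : ChenRelations T A1 A2)
    (hAK : DriverNormBound γ T A1 A2 K) {f : ℝ → A} {s t H ε : ℝ} (hs : 0 ≤ s)
    (ht : (t : EReal) < T) (hH0 : 0 ≤ H) (hH1 : H ≤ 1) (hHε : H ^ γ ≤ ε)
    (hKε : 2 * K * ε ≤ θ / 2) (hcε : (2 * K + 6 * K ^ 2 / θ) * ε ≤ 1 / 2)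
    (hM : ∃ M, ∀ u, s ≤ u → u ≤ t → ‖f u - 1‖ ≤ M)
    (hL : ∃ L, ∀ u v, s ≤ u → u ≤ v → v ≤ t →
      ‖flowRemainder A1 A2 f v u‖ ≤ L * (v - u) ^ (3 * γ))
    (hfs : f s = 1) (n : ℕ) :
    ∀ u, s ≤ u → u ≤ t → u ≤ s + n * H → 1 + ‖f u - 1‖ ≤ 2 ^ n := by
  induction n with
  | zero =>
    intro u hsu _ hu
    obtain rfl : u = s := le_antisymm (by simpa using hu) hsu
    simp [hfs]
  | succ n ih =>
    intro u hsu hut hu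
    push_cast at hu
    by_cases hn : u ≤ s + n * H
    · exact (ih u hsu hut hn).trans (pow_le_pow_right₀ (by norm_num) n.le_succ)
    · have hnH : 0 ≤ n * H := by positivity
      have hsa : s ≤ s + n * H := by linarith
      have hle : u - (s + n * H) ≤ H := by linarith
      have hstep := norm_sub_one_le_of_short hγ hK hθ0 hθ hA hAK (a := s + n * H) (b := u)
        (by linarith) (lt_of_le_of_lt (EReal.coe_le_coe_iff.2 hut) ht) (by linarith)
        ((Real.rpow_le_rpow (by linarith) hle hγ).trans hHε) hKε hcε
        (hM.imp fun M h z h1 h2 => h z (by linarith) (by linarith))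
        (hL.imp fun L h z y h1 h2 h3 => h z y (by linarith) h2 (by linarith))
        (by linarith) le_rfl
      have := ih (s + n * H) hsa (by linarith) le_rfl
      rw [pow_succ]
      linarith

theorem exists_rpow_le {γ ε : ℝ} (hγ : 0 < γ) (hε : 0 < ε) :
    ∃ H : ℝ, 0 < H ∧ H ≤ 1 ∧ H ^ γ ≤ ε := by
  refine ⟨min ε 1 ^ γ⁻¹, by positivity, ?_, ?_⟩
  · exact Real.rpow_le_one (by positivity) (min_le_right _ _) (by positivity)
  · rw [Real.rpow_inv_rpow (by positivity) hγ.ne']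
    exact min_le_left _ _

theorem taylor_bounds_for_flow
    (γ : ℝ) (hγ1 : 1 / 3 < γ) (hγ2 : γ ≤ 1 / 2) (K : ℝ) :
    ∃ C : ℝ, 0 < C ∧
      ∀ (A : Type) [NormedRing A] [NormedAlgebra ℝ A] [CompleteSpace A]
        (T : EReal), 0 < T →
      ∀ (A1 A2 : ℝ → ℝ → A), ChenRelations T A1 A2 →
        DriverNormBound γ T A1 A2 K →
      ∀ e : ℝ → ℝ → A,
        (∀ s : ℝ, 0 ≤ s → (s : EReal) < T → e s s = 1) →
        (∀ s : ℝ, 0 ≤ s → (s : EReal) < T →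
          LocallyHolderFrom γ s T (fun t u => e t s - e u s)) →
        (∀ s : ℝ, 0 ≤ s → (s : EReal) < T →
          LocallyHolderFrom (3 * γ) s T
            (fun t u => e t s - e u s - (A1 t u + A2 t u) * e u s)) →
      ∀ s t : ℝ, 0 ≤ s → s ≤ t → (t : EReal) < T → t - s ≤ 1 →
        ‖e t s - 1‖ ≤ C * (t - s) ^ γ ∧
        ‖e t s - 1 - A1 t s - A2 t s‖ ≤ C * (t - s) ^ (3 * γ) := by
  have hγ0 : 0 < γ := by linarith
  obtain ⟨k, hk⟩ : ∃ k, k = max K 0 := ⟨_, rfl⟩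
  have hk0 : 0 ≤ k := hk ▸ le_max_right _ _
  obtain ⟨θ, hθ⟩ : ∃ θ : ℝ, (2 : ℝ) ^ (1 - 3 * γ) = 1 - θ := ⟨1 - 2 ^ (1 - 3 * γ), by ring⟩
  have hθ0 : 0 < θ := by
    have := Real.rpow_lt_one_of_one_lt_of_neg (x := 2) (z := 1 - 3 * γ) (by norm_num)
      (by linarith)
    linarith
  obtain ⟨c, hc⟩ : ∃ c, c = 6 * k ^ 2 / θ := ⟨_, rfl⟩
  have hc0 : 0 ≤ c := by rw [hc]; positivity
  obtain ⟨ε, hε0, hKε, hcε⟩ :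
      ∃ ε : ℝ, 0 < ε ∧ 2 * k * ε ≤ θ / 2 ∧ (2 * k + 6 * k ^ 2 / θ) * ε ≤ 1 / 2 := by
    rw [← hc]
    refine ⟨min (θ / 2) (1 / 2) / (1 + 2 * k + c), by positivity, ?_, ?_⟩
    · rw [mul_div_assoc', div_le_iff₀ (by positivity), mul_comm (θ / 2)]
      exact mul_le_mul (by linarith) (min_le_left _ _) (by positivity) (by positivity)
    · rw [mul_div_assoc', div_le_iff₀ (by positivity), mul_comm (1 / 2 : ℝ)]
      exact mul_le_mul (by linarith) (min_le_right _ _) (by positivity) (by positivity)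
  obtain ⟨H, hH0, hH1, hHε⟩ := exists_rpow_le hγ0 hε0
  obtain ⟨N, hN⟩ := exists_nat_ge (1 / H)
  rw [div_le_iff₀ hH0] at hN
  have hHp : 0 < H ^ (3 * γ) := by positivity
  obtain ⟨D, hD⟩ : ∃ D, D = 2 * c + (2 ^ N + 2 * k) / H ^ (3 * γ) := ⟨_, rfl⟩
  have hD0 : 0 ≤ D := by rw [hD]; positivity
  refine ⟨2 * k + D + 1, by positivity, ?_⟩
  intro A _ _ _ T _ A1 A2 hA hAK e he1 heH heR s t hs hst ht hts
  have hsT : (s : EReal) < T := lt_of_le_of_lt (EReal.coe_le_coe_iff.2 hst) ht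
  have hAk : DriverNormBound γ T A1 A2 k := by
    intro s t hs hst ht hts
    obtain ⟨h1, h2⟩ := hAK s t hs hst ht hts
    have hKk : K ≤ k := hk ▸ le_max_left _ _
    have hh0 : 0 ≤ t - s := by linarith
    exact ⟨h1.trans (by gcongr), h2.trans (by gcongr)⟩
  obtain ⟨f, hf⟩ : ∃ f : ℝ → A, f = fun u => e u s := ⟨_, rfl⟩
  have hfs : f s = 1 := by rw [hf]; exact he1 s hs hsT
  have hM : ∃ M, ∀ u, s ≤ u → u ≤ t → ‖f u - 1‖ ≤ M := by
    obtain ⟨M, hM⟩ := heH s hs hsT t ht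
    refine ⟨|M|, fun u hsu hut => ?_⟩
    have h := hM s u le_rfl hsu hut (by linarith)
    have h0 : 0 ≤ (u - s) ^ γ := Real.rpow_nonneg (by linarith) _
    have h1 : (u - s) ^ γ ≤ 1 := Real.rpow_le_one (by linarith) (by linarith) hγ0.le
    rw [← hfs, hf]
    exact h.trans ((mul_le_mul_of_nonneg_right (le_abs_self M) h0).trans
      (mul_le_of_le_one_right (abs_nonneg M) h1))
  have hL : ∃ L, ∀ u v, s ≤ u → u ≤ v → v ≤ t →
      ‖flowRemainder A1 A2 f v u‖ ≤ L * (v - u) ^ (3 * γ) := by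
    obtain ⟨L, hL⟩ := heR s hs hsT t ht
    refine ⟨L, fun u v hsu huv hvt => ?_⟩
    rw [hf]
    exact hL u v hsu huv hvt (by linarith)
  have hh0 : 0 ≤ t - s := by linarith
  obtain ⟨h1, h2⟩ := hAk s t hs hst ht hts
  have hrem : e t s - 1 - A1 t s - A2 t s = flowRemainder A1 A2 f t s := by
    rw [flowRemainder, hfs, hf, mul_one]; abel
  have hp : ∀ {x : ℝ}, γ ≤ x → (t - s) ^ x ≤ (t - s) ^ γ := fun {x} hx =>
    Real.rpow_le_rpow_of_exponent_ge' hh0 hts hγ0.le hx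
  have hR : ‖flowRemainder A1 A2 f t s‖ ≤ D * (t - s) ^ (3 * γ) := by
    rcases le_or_gt (t - s) H with hle | hlt
    · have hε := (Real.rpow_le_rpow hh0 hle hγ0.le).trans hHε
      have hG : ∀ u, s ≤ u → u ≤ t → ‖f u - 1‖ ≤ 1 := fun u hsu hut => by
        simpa [hfs] using norm_sub_one_le_of_short hγ0.le hk0 hθ0 hθ hA hAk hs ht hts hε hKε hcε
          hM hL hsu hut
      refine (norm_flowRemainder_le_of_short hγ0.le hk0 hθ0 hθ hA hAk hs ht hts hε hKε
        zero_le_one hG hL le_rfl hst le_rfl).trans ?_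
      rw [← hc, hD]
      have : 0 ≤ (2 ^ N + 2 * k) / H ^ (3 * γ) := by positivity
      gcongr
      linarith
    · have hg := one_add_norm_sub_one_le_two_pow hγ0.le hk0 hθ0 hθ hA hAk hs ht hH0.le hH1 hHε
        hKε hcε hM hL hfs N t hst le_rfl (by linarith)
      have hle1 : ∀ {x : ℝ}, 0 ≤ x → (t - s) ^ x ≤ 1 := Real.rpow_le_one hh0 hts
      have hcr : ‖flowRemainder A1 A2 f t s‖ ≤ 2 ^ N + 2 * k := by
        have h1' := h1.trans (mul_le_of_le_one_right hk0 (hle1 hγ0.le))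
        have h2' := h2.trans (mul_le_of_le_one_right hk0 (hle1 (by linarith)))
        rw [← hrem]
        have hft : e t s = f t := by rw [hf]
        rw [hft]
        have := norm_sub_le (f t - 1 - A1 t s) (A2 t s)
        have := norm_sub_le (f t - 1) (A1 t s)
        linarith
      calc _ ≤ 2 ^ N + 2 * k := hcr
        _ = (2 ^ N + 2 * k) / H ^ (3 * γ) * H ^ (3 * γ) := by field_simp
        _ ≤ (2 ^ N + 2 * k) / H ^ (3 * γ) * (t - s) ^ (3 * γ) := by gcongr
        _ ≤ D * (t - s) ^ (3 * γ) := by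
          have := Real.rpow_nonneg hh0 (3 * γ)
          rw [hD]
          gcongr
          linarith
  constructor
  · have heq : e t s - 1 = A1 t s + A2 t s + flowRemainder A1 A2 f t s := by
      rw [← hrem]; abel
    rw [heq]
    calc _ ≤ ‖A1 t s‖ + ‖A2 t s‖ + ‖flowRemainder A1 A2 f t s‖ := norm_add₃_le
      _ ≤ k * (t - s) ^ γ + k * (t - s) ^ (2 * γ) + D * (t - s) ^ (3 * γ) := by gcongr
      _ ≤ k * (t - s) ^ γ + k * (t - s) ^ γ + D * (t - s) ^ γ := by
        gcongr k * _ + k * ?_ + D * ?_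
        · exact hp (by linarith)
        · exact hp (by linarith)
      _ ≤ _ := by
        have := Real.rpow_nonneg hh0 γ
        linarith
  · rw [hrem]
    refine hR.trans ?_
    gcongr
    linarith
end

section
/- Let H be a Hilbert space, 1/3 < γ ≤ 1/2, T ∈ (0,∞], and let 𝐀 = (A¹,A²) be a bounded γ-rough driver with values in the Banach algebra L(H) of bounded operators on H which is conservative: (A¹_{ts})* + A¹_{ts} = 0 and (A²_{ts})* + A²_{ts} + (A¹_{ts})* A¹_{ts} = 0 for all 0 ≤ s ≤ t < T. Then for every f₀ ∈ H, any path f : [0,T) → H with f(0) = f₀, γ-Hölder on bounded intervals and such that f♯_{ts} := f_t − f_s − (A¹_{ts}+A²_{ts}) f_s is locally 3γ-Hölder, satisfies ‖f_t‖_H = ‖f₀‖_H for all t ∈ [0,T). -/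
/-!
STATEMENT 10 (norm preservation for conservative bounded drivers on a Hilbert
space).  Here `𝒜 = L(H)` is the Banach algebra of bounded operators on a
Hilbert space `H`, `*` denotes the Hilbert-space adjoint, and `T ∈ (0,∞]` is
modelled as `T : EReal`.
-/

/-- Chen's relations for a pair of operator-valued 2-index maps on `[0,T)`. -/
def ChenRelationsOp {H : Type} [NormedAddCommGroup H] [InnerProductSpace ℝ H]
    (T : EReal) (A1 A2 : ℝ → ℝ → H →L[ℝ] H) : Prop :=
  ∀ s u t : ℝ, 0 ≤ s → s ≤ u → u ≤ t → (t : EReal) < T →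
    A1 t s = A1 t u + A1 u s ∧
    A2 t s = A2 t u + A2 u s + (A1 t u).comp (A1 u s)

/-- `K` is an upper bound for the rough-driver norm `‖𝐀‖`. -/
def DriverNormBoundOp {H : Type} [NormedAddCommGroup H] [InnerProductSpace ℝ H]
    (γ : ℝ) (T : EReal) (A1 A2 : ℝ → ℝ → H →L[ℝ] H) (K : ℝ) : Prop :=
  ∀ s t : ℝ, 0 ≤ s → s ≤ t → (t : EReal) < T → t - s ≤ 1 →
    ‖A1 t s‖ ≤ K * (t - s) ^ γ ∧ ‖A2 t s‖ ≤ K * (t - s) ^ (2 * γ)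

open Set Filter Topology

/-- A function which is superlinearly close to its value at `x` on the right of `x` has right
derivative zero at `x`. -/
theorem hasDerivWithinAt_zero_of_abs_sub_le_rpow {g : ℝ → ℝ} {x M p : ℝ} (hp : 1 < p)
    (hg : ∀ᶠ t in 𝓝[>] x, |g t - g x| ≤ M * (t - x) ^ p) :
    HasDerivWithinAt g 0 (Ici x) x := by
  rw [← hasDerivWithinAt_Ioi_iff_Ici, hasDerivWithinAt_iff_tendsto_slope' (by simp)]
  have hlim : Tendsto (fun t : ℝ => M * (t - x) ^ (p - 1)) (𝓝[>] x) (𝓝 0) := by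
    have hc : ContinuousAt (fun t : ℝ => M * (t - x) ^ (p - 1)) x :=
      ((continuousAt_id.sub continuousAt_const).rpow_const (Or.inr (by linarith))).const_mul M
    have h0 : M * (x - x) ^ (p - 1) = 0 := by
      rw [sub_self, Real.zero_rpow (by linarith), mul_zero]
    have := hc.tendsto
    rw [h0] at this
    exact this.mono_left nhdsWithin_le_nhds
  refine squeeze_zero_norm' ?_ hlim
  filter_upwards [hg, self_mem_nhdsWithin] with t ht hxt
  have hpos : 0 < t - x := sub_pos.2 hxt
  rw [slope_def_field, Real.norm_eq_abs, abs_div, abs_of_pos hpos, div_le_iff₀ hpos, mul_assoc,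
    ← Real.rpow_add_one hpos.ne', sub_add_cancel]
  exact ht

/-- A locally Hölder path is continuous on compact intervals. -/
theorem LocallyHolder.continuousOn {E : Type} [NormedAddCommGroup E] {β : ℝ} (hβ : 0 < β)
    {T : EReal} {f : ℝ → E} (hf : LocallyHolder β T (fun t s => f t - f s))
    {S : ℝ} (hS : (S : EReal) < T) : ContinuousOn f (Icc 0 S) := by
  obtain ⟨C, hC⟩ := hf S hS
  intro x hx
  rw [ContinuousWithinAt, tendsto_iff_norm_sub_tendsto_zero]
  have hlim : Tendsto (fun t : ℝ => C * |t - x| ^ β) (𝓝[Icc 0 S] x) (𝓝 0) := by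
    have hc : ContinuousAt (fun t : ℝ => C * |t - x| ^ β) x :=
      (((continuousAt_id.sub continuousAt_const).abs).rpow_const (Or.inr hβ.le)).const_mul C
    have h0 : C * |x - x| ^ β = 0 := by
      rw [sub_self, abs_zero, Real.zero_rpow hβ.ne', mul_zero]
    have := hc.tendsto
    rw [h0] at this
    exact this.mono_left nhdsWithin_le_nhds
  refine squeeze_zero' (Eventually.of_forall fun _ => norm_nonneg _) ?_ hlim
  filter_upwards [self_mem_nhdsWithin,
    nhdsWithin_le_nhds (Metric.ball_mem_nhds x one_pos)] with t ht hball
  rw [Metric.mem_ball, Real.dist_eq] at hball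
  rcases le_total x t with h | h
  · rw [abs_of_nonneg (sub_nonneg.2 h)] at hball ⊢
    exact hC x t hx.1 h ht.2 hball.le
  · rw [abs_sub_comm, abs_of_nonneg (sub_nonneg.2 h)] at hball ⊢
    rw [norm_sub_rev]
    exact hC t x ht.1 h hx.2 hball.le

/-- The second-order expansion generated by a conservative pair of operators preserves the square
of the norm up to terms of order three. -/
theorem norm_sq_add_of_conservative {H : Type} [NormedAddCommGroup H] [InnerProductSpace ℝ H]
    [CompleteSpace H] {B₁ B₂ : H →L[ℝ] H}
    (h₁ : ContinuousLinearMap.adjoint B₁ + B₁ = 0)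
    (h₂ : ContinuousLinearMap.adjoint B₂ + B₂
      + (ContinuousLinearMap.adjoint B₁).comp B₁ = 0) (v : H) :
    ‖v + (B₁ + B₂) v‖ ^ 2 = ‖v‖ ^ 2 + 2 * inner ℝ (B₁ v) (B₂ v) + ‖B₂ v‖ ^ 2 := by
  have e₁ : inner ℝ v (B₁ v) = 0 := by
    have := congrArg (fun L : H →L[ℝ] H => inner ℝ (L v) v) h₁
    simp only [add_apply, inner_add_left, ContinuousLinearMap.adjoint_inner_left,
      zero_apply, inner_zero_left, real_inner_comm v (B₁ v)] at this
    linarith [real_inner_comm v (B₁ v)]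
  have e₂ : 2 * inner ℝ v (B₂ v) + ‖B₁ v‖ ^ 2 = 0 := by
    have := congrArg (fun L : H →L[ℝ] H => inner ℝ (L v) v) h₂
    simp only [add_apply, inner_add_left, ContinuousLinearMap.adjoint_inner_left,
      ContinuousLinearMap.comp_apply, zero_apply, inner_zero_left,
      real_inner_self_eq_norm_sq] at this
    linarith [real_inner_comm v (B₂ v)]
  rw [add_apply, norm_add_sq_real, norm_add_sq_real, inner_add_right]
  linarith

/-- A third-order perturbation of the second-order expansion generated by a conservative pair of
operators changes the square of the norm by a term of order three. -/
theorem abs_norm_sq_sub_le_of_conservative {H : Type} [NormedAddCommGroup H]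
    [InnerProductSpace ℝ H] [CompleteSpace H] {B₁ B₂ : H →L[ℝ] H}
    (h₁ : ContinuousLinearMap.adjoint B₁ + B₁ = 0)
    (h₂ : ContinuousLinearMap.adjoint B₂ + B₂
      + (ContinuousLinearMap.adjoint B₁).comp B₁ = 0) {v w : H} {K C x : ℝ}
    (hK : 0 ≤ K) (hC : 0 ≤ C) (hx : 0 ≤ x) (hx1 : x ≤ 1)
    (hB₁ : ‖B₁‖ ≤ K * x) (hB₂ : ‖B₂‖ ≤ K * x ^ 2)
    (hw : ‖w - v - (B₁ + B₂) v‖ ≤ C * x ^ 3) :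
    |‖w‖ ^ 2 - ‖v‖ ^ 2| ≤
      (3 * (K * ‖v‖) ^ 2 + C * (2 * (‖v‖ + 2 * (K * ‖v‖)) + C)) * x ^ 3 := by
  have hx2 : x ^ 2 ≤ 1 := pow_le_one₀ hx hx1
  have hx3 : x ^ 3 ≤ 1 := pow_le_one₀ hx hx1
  have b₁ : ‖B₁ v‖ ≤ K * ‖v‖ * x :=
    (B₁.le_of_opNorm_le hB₁ v).trans_eq (by ring)
  have b₂ : ‖B₂ v‖ ≤ K * ‖v‖ * x ^ 2 :=
    (B₂.le_of_opNorm_le hB₂ v).trans_eq (by ring)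
  set r := w - v - (B₁ + B₂) v with hr
  set u := v + (B₁ + B₂) v with hu
  have hwu : w = u + r := by rw [hr, hu]; abel
  have hF : 0 ≤ K * ‖v‖ := by positivity
  have hun : ‖u‖ ≤ ‖v‖ + 2 * (K * ‖v‖) := by
    have h1 : ‖u‖ ≤ ‖v‖ + (‖B₁ v‖ + ‖B₂ v‖) :=
      (norm_add_le _ _).trans (by gcongr; exact norm_add_le _ _)
    nlinarith
  have hu2 := norm_sq_add_of_conservative h₁ h₂ v
  rw [← hu] at hu2
  have hI : |inner ℝ (B₁ v) (B₂ v)| ≤ (K * ‖v‖) ^ 2 * x ^ 3 :=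
    (abs_real_inner_le_norm _ _).trans
      ((mul_le_mul b₁ b₂ (norm_nonneg _) (by positivity)).trans_eq (by ring))
  have hS : ‖B₂ v‖ ^ 2 ≤ (K * ‖v‖) ^ 2 * x ^ 3 := by
    calc ‖B₂ v‖ ^ 2 ≤ (K * ‖v‖ * x ^ 2) ^ 2 := by gcongr
      _ = (K * ‖v‖) ^ 2 * x ^ 3 * x := by ring
      _ ≤ (K * ‖v‖) ^ 2 * x ^ 3 := mul_le_of_le_one_right (by positivity) hx1
  have hJ : |inner ℝ u r| ≤ (‖v‖ + 2 * (K * ‖v‖)) * (C * x ^ 3) :=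
    (abs_real_inner_le_norm _ _).trans (mul_le_mul hun hw (norm_nonneg _) (by positivity))
  have hR : ‖r‖ ^ 2 ≤ C * C * x ^ 3 := by
    calc ‖r‖ ^ 2 ≤ (C * x ^ 3) ^ 2 := by gcongr
      _ = C * C * x ^ 3 * x ^ 3 := by ring
      _ ≤ C * C * x ^ 3 := mul_le_of_le_one_right (by positivity) hx3
  rw [hwu, norm_add_sq_real, hu2]
  rw [abs_le] at hI hJ ⊢
  have := sq_nonneg ‖r‖
  have := sq_nonneg ‖B₂ v‖
  constructor <;> linarith

theorem norm_preservation_conservative_driver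
    (H : Type) [NormedAddCommGroup H] [InnerProductSpace ℝ H] [CompleteSpace H]
    (γ : ℝ) (hγ1 : 1 / 3 < γ) (hγ2 : γ ≤ 1 / 2)
    (T : EReal) (hT : 0 < T)
    (A1 A2 : ℝ → ℝ → H →L[ℝ] H)
    (hChen : ChenRelationsOp T A1 A2)
    (hNorm : ∃ K : ℝ, DriverNormBoundOp γ T A1 A2 K)
    (hCons1 : ∀ s t : ℝ, 0 ≤ s → s ≤ t → (t : EReal) < T →
      ContinuousLinearMap.adjoint (A1 t s) + A1 t s = 0)
    (hCons2 : ∀ s t : ℝ, 0 ≤ s → s ≤ t → (t : EReal) < T →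
      ContinuousLinearMap.adjoint (A2 t s) + A2 t s
        + (ContinuousLinearMap.adjoint (A1 t s)).comp (A1 t s) = 0)
    (f₀ : H) (f : ℝ → H) (hf0 : f 0 = f₀)
    (hHolder : LocallyHolder γ T (fun t s => f t - f s))
    (hRem : LocallyHolder (3 * γ) T
      (fun t s => f t - f s - (A1 t s + A2 t s) (f s))) :
    ∀ t : ℝ, 0 ≤ t → (t : EReal) < T → ‖f t‖ = ‖f₀‖ := by
  intro S hS0 hST
  obtain ⟨K, hK⟩ := hNorm
  obtain ⟨C, hC⟩ := hRem S hST
  have hcont : ContinuousOn (fun t => ‖f t‖ ^ 2) (Icc 0 S) :=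
    ((hHolder.continuousOn (by linarith) hST).norm).pow 2
  have hderiv : ∀ s ∈ Ico 0 S, HasDerivWithinAt (fun t => ‖f t‖ ^ 2) 0 (Ici s) s := by
    intro s hs
    refine hasDerivWithinAt_zero_of_abs_sub_le_rpow (p := 3 * γ)
      (M := 3 * (|K| * ‖f s‖) ^ 2 + |C| * (2 * (‖f s‖ + 2 * (|K| * ‖f s‖)) + |C|))
      (by linarith) ?_
    filter_upwards [Ioo_mem_nhdsGT hs.2, Ioo_mem_nhdsGT (lt_add_one s)] with t htS ht1
    have hst : s ≤ t := htS.1.le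
    have h0 : 0 ≤ t - s := sub_nonneg.2 hst
    have h1 : t - s ≤ 1 := by linarith [ht1.2]
    have htT : (t : EReal) < T := (EReal.coe_lt_coe_iff.2 htS.2).trans hST
    have p2 : (t - s) ^ (2 * γ) = ((t - s) ^ γ) ^ 2 := by
      rw [mul_comm, Real.rpow_mul h0]; norm_cast
    have p3 : (t - s) ^ (3 * γ) = ((t - s) ^ γ) ^ 3 := by
      rw [mul_comm, Real.rpow_mul h0]; norm_cast
    have hx : 0 ≤ (t - s) ^ γ := Real.rpow_nonneg h0 γ
    obtain ⟨k1, k2⟩ := hK s t hs.1 hst htT h1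
    have k3 := hC s t hs.1 hst htS.2.le h1
    rw [p2] at k2
    rw [p3] at k3 ⊢
    exact abs_norm_sq_sub_le_of_conservative (hCons1 s t hs.1 hst htT) (hCons2 s t hs.1 hst htT)
      (abs_nonneg K) (abs_nonneg C) hx (Real.rpow_le_one h0 h1 (by linarith))
      (k1.trans (by gcongr; exact le_abs_self K)) (k2.trans (by gcongr; exact le_abs_self K))
      (k3.trans (by gcongr; exact le_abs_self C))
  have h := constant_of_has_deriv_right_zero hcont hderiv S (right_mem_Icc.2 hS0)
  rw [← hf0]
  exact (sq_eq_sq₀ (norm_nonneg _) (norm_nonneg _)).1 h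
end
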